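/- Suppose P is a nonzero Kantor pair over 𝕂. Then: (i) P is simple if and only if there exists a 5-graded Lie algebra L enveloping P such that L is a simple Lie algebra; (ii) if L is a simple 5-graded Lie algebra that envelops P, then there exists a unique isomorphism of 5-graded Lie algebras from L onto 𝔎(P) (with its standard 5-grading) extending the identity on T_L(P) = P⁻ ⊕ P⁺. -/

import Mathlib

/-- A Kantor pair over `K`: a pair of modules `(Pm, Pp)` (for `P⁻`, `P⁺`) with trilinear
products `tm : P⁻ × P⁺ × P⁻ → P⁻` and `tp : P⁺ × P⁻ × P⁺ → P⁺` satisfying the Kantor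
identities (K1) and (K2). -/
structure KantorPair (K : Type*) [CommRing K] (Pm Pp : Type*)
    [AddCommGroup Pm] [AddCommGroup Pp] [Module K Pm] [Module K Pp] where
  tm : Pm → Pp → Pm → Pm
  tp : Pp → Pm → Pp → Pp
  tm_add₁ : ∀ x x' y z, tm (x + x') y z = tm x y z + tm x' y z
  tm_smul₁ : ∀ (a : K) x y z, tm (a • x) y z = a • tm x y z
  tm_add₂ : ∀ x y y' z, tm x (y + y') z = tm x y z + tm x y' z
  tm_smul₂ : ∀ (a : K) x y z, tm x (a • y) z = a • tm x y z
  tm_add₃ : ∀ x y z z', tm x y (z + z') = tm x y z + tm x y z'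
  tm_smul₃ : ∀ (a : K) x y z, tm x y (a • z) = a • tm x y z
  tp_add₁ : ∀ x x' y z, tp (x + x') y z = tp x y z + tp x' y z
  tp_smul₁ : ∀ (a : K) x y z, tp (a • x) y z = a • tp x y z
  tp_add₂ : ∀ x y y' z, tp x (y + y') z = tp x y z + tp x y' z
  tp_smul₂ : ∀ (a : K) x y z, tp x (a • y) z = a • tp x y z
  tp_add₃ : ∀ x y z z', tp x y (z + z') = tp x y z + tp x y z'
  tp_smul₃ : ∀ (a : K) x y z, tp x y (a • z) = a • tp x y z
  k1m : ∀ (x z u : Pm) (y w : Pp),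
    tm x y (tm z w u) - tm z w (tm x y u) = tm (tm x y z) w u - tm z (tp y x w) u
  k1p : ∀ (x z u : Pp) (y w : Pm),
    tp x y (tp z w u) - tp z w (tp x y u) = tp (tp x y z) w u - tp z (tm y x w) u
  k2m : ∀ (x z u : Pm) (w v : Pp),
    (tm x (tp w u v) z - tm z (tp w u v) x) + tm u w (tm x v z - tm z v x)
      = tm (tm x w z - tm z w x) v u - tm u v (tm x w z - tm z w x)
  k2p : ∀ (x z u : Pp) (w v : Pm),
    (tp x (tm w u v) z - tp z (tm w u v) x) + tp u w (tp x v z - tp z v x)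
      = tp (tp x w z - tp z w x) v u - tp u v (tp x w z - tp z w x)

namespace KantorPair

variable {K : Type*} [CommRing K] {Pm Pp : Type*}
  [AddCommGroup Pm] [AddCommGroup Pp] [Module K Pm] [Module K Pp]

/-- `Q = (Qm, Qp)` is an ideal of the Kantor pair:
`{P,P,Q} + {P,Q,P} + {Q,P,P} ⊆ Q` on each side. -/
def IsIdealPair (KP : KantorPair K Pm Pp) (Qm : Submodule K Pm) (Qp : Submodule K Pp) : Prop :=
  (∀ (x z : Pm) (y : Pp) (q : Pm), q ∈ Qm → KP.tm x y q ∈ Qm ∧ KP.tm q y z ∈ Qm) ∧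
  (∀ (x z : Pm) (r : Pp), r ∈ Qp → KP.tm x r z ∈ Qm) ∧
  (∀ (x z : Pp) (y : Pm) (q : Pp), q ∈ Qp → KP.tp x y q ∈ Qp ∧ KP.tp q y z ∈ Qp) ∧
  (∀ (x z : Pp) (r : Pm), r ∈ Qm → KP.tp x r z ∈ Qp)

/-- A Kantor pair is simple if some product is nonzero and its only ideals are `0` and `P`. -/
def IsSimplePair (KP : KantorPair K Pm Pp) : Prop :=
  ((∃ x y z, KP.tm x y z ≠ 0) ∨ (∃ x y z, KP.tp x y z ≠ 0)) ∧
  ∀ Qm Qp, KP.IsIdealPair Qm Qp → (Qm = ⊥ ∧ Qp = ⊥) ∨ (Qm = ⊤ ∧ Qp = ⊤)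

/-- `(ωm, ωp)` belongs to the centroid of the Kantor pair. -/
def InCentroid (KP : KantorPair K Pm Pp) (ωm : Pm →ₗ[K] Pm) (ωp : Pp →ₗ[K] Pp) : Prop :=
  (∀ x y z, ωm (KP.tm x y z) = KP.tm (ωm x) y z ∧
      ωm (KP.tm x y z) = KP.tm x (ωp y) z ∧ ωm (KP.tm x y z) = KP.tm x y (ωm z)) ∧
  (∀ x y z, ωp (KP.tp x y z) = KP.tp (ωp x) y z ∧
      ωp (KP.tp x y z) = KP.tp x (ωm y) z ∧ ωp (KP.tp x y z) = KP.tp x y (ωp z))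

/-- The Kantor pair is central: `a ↦ (a • id, a • id)` is an isomorphism of `K`
onto the centroid. -/
def IsCentralPair (KP : KantorPair K Pm Pp) : Prop :=
  (∀ ωm ωp, KP.InCentroid ωm ωp →
    ∃ a : K, ωm = a • (LinearMap.id : Pm →ₗ[K] Pm) ∧ ωp = a • (LinearMap.id : Pp →ₗ[K] Pp)) ∧
  ∀ a : K, a • (LinearMap.id : Pm →ₗ[K] Pm) = 0 →
    a • (LinearMap.id : Pp →ₗ[K] Pp) = 0 → a = 0

/-- A Jordan pair is a Kantor pair with vanishing K-operators, i.e. symmetric products. -/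
def IsJordanPair (KP : KantorPair K Pm Pp) : Prop :=
  (∀ (x z : Pm) (y : Pp), KP.tm x y z = KP.tm z y x) ∧
  (∀ (x z : Pp) (y : Pm), KP.tp x y z = KP.tp z y x)

end KantorPair

/-- A 5-grading (= BC₁-grading) of a Lie algebra `L` over `K`:
an internal direct sum decomposition `L = ⊕_{i ∈ ℤ} L_i` with `⁅L_i, L_j⁆ ⊆ L_{i+j}`
and `L_i = 0` for `|i| > 2`. -/
structure FiveGrading (K : Type*) [CommRing K] (L : Type*) [LieRing L] [LieAlgebra K L] where
  g : ℤ → Submodule K L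
  internal : DirectSum.IsInternal g
  lie_mem : ∀ (i j : ℤ) (x y : L), x ∈ g i → y ∈ g j → ⁅x, y⁆ ∈ g (i + j)
  vanish : ∀ i : ℤ, 2 < |i| → g i = ⊥

/-- `T_L(P) = L_{-1} ⊕ L_1` as a submodule of `L`. -/
def Tsub {K : Type*} [CommRing K] {L : Type*} [LieRing L] [LieAlgebra K L]
    (fg : FiveGrading K L) : Submodule K L :=
  fg.g (-1) ⊔ fg.g 1

/-- The span of all brackets `⁅x, y⁆` with `x ∈ U`, `y ∈ V`. -/
def brkSpan (K : Type*) [CommRing K] {L : Type*} [LieRing L] [LieAlgebra K L]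
    (U V : Submodule K L) : Submodule K L :=
  Submodule.span K {w : L | ∃ x ∈ U, ∃ y ∈ V, w = ⁅x, y⁆}

/-- A 5-graded Lie algebra `L` tightly envelops the Kantor pair `(L_{-1}, L_1)` if it
is generated as a Lie algebra by `T = L_{-1} ⊕ L_1` and `Z(L) ∩ [T, T] = 0`. -/
def Tight (K : Type*) [CommRing K] {L : Type*} [LieRing L] [LieAlgebra K L]
    (fg : FiveGrading K L) : Prop :=
  LieSubalgebra.lieSpan K L ↑(Tsub fg) = ⊤ ∧
  ∀ z ∈ brkSpan K (Tsub fg) (Tsub fg), (∀ u : L, ⁅z, u⁆ = 0) → z = 0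

/-- A 5-graded Lie algebra `(L, fg)` envelops a Kantor pair `KP`: there are identifications
of `P⁻` with `L_{-1}` and `P⁺` with `L_1` under which the products of `KP` are the products
`⁅⁅x, y⁆, z⁆` of `L`. -/
structure Envelops {K : Type*} [CommRing K] {Pm Pp : Type*}
    [AddCommGroup Pm] [AddCommGroup Pp] [Module K Pm] [Module K Pp]
    (KP : KantorPair K Pm Pp)
    {L : Type*} [LieRing L] [LieAlgebra K L] (fg : FiveGrading K L) where
  em : Pm →ₗ[K] L
  ep : Pp →ₗ[K] L
  inj_m : Function.Injective em
  inj_p : Function.Injective ep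
  range_m : LinearMap.range em = fg.g (-1)
  range_p : LinearMap.range ep = fg.g 1
  compat_m : ∀ (x z : Pm) (y : Pp), em (KP.tm x y z) = ⁅⁅em x, ep y⁆, em z⁆
  compat_p : ∀ (x z : Pp) (y : Pm), ep (KP.tp x y z) = ⁅⁅ep x, em y⁆, ep z⁆

/-- A short Peirce grading (SP-grading) of a Kantor pair: a `ℤ`-grading with support
contained in `{0, 1}`. -/
structure SPGrading {K : Type*} [CommRing K] {Pm Pp : Type*}
    [AddCommGroup Pm] [AddCommGroup Pp] [Module K Pm] [Module K Pp]
    (KP : KantorPair K Pm Pp) where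
  Qm : ℤ → Submodule K Pm
  Qp : ℤ → Submodule K Pp
  sup_m : Qm 0 ⊔ Qm 1 = ⊤
  disj_m : Disjoint (Qm 0) (Qm 1)
  sup_p : Qp 0 ⊔ Qp 1 = ⊤
  disj_p : Disjoint (Qp 0) (Qp 1)
  vanish_m : ∀ i : ℤ, i ≠ 0 → i ≠ 1 → Qm i = ⊥
  vanish_p : ∀ i : ℤ, i ≠ 0 → i ≠ 1 → Qp i = ⊥
  grade_m : ∀ (i j k : ℤ) (x : Pm) (y : Pp) (z : Pm),
    x ∈ Qm i → y ∈ Qp j → z ∈ Qm k → KP.tm x y z ∈ Qm (i - j + k)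
  grade_p : ∀ (i j k : ℤ) (x : Pp) (y : Pm) (z : Pp),
    x ∈ Qp i → y ∈ Qm j → z ∈ Qp k → KP.tp x y z ∈ Qp (i - j + k)

/-- `KPc` is the reflection `P̌` of the SP-graded Kantor pair `(KP, SP)`:
`P̌^σ = P₀^{-σ} ⊕ P₁^σ`, with products given by the reflection formula. -/
def IsReflection {K : Type*} [CommRing K] {Pm Pp : Type*}
    [AddCommGroup Pm] [AddCommGroup Pp] [Module K Pm] [Module K Pp]
    (KP : KantorPair K Pm Pp) (SP : SPGrading KP)
    (KPc : KantorPair K ((SP.Qp 0) × (SP.Qm 1)) ((SP.Qm 0) × (SP.Qp 1))) : Prop :=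
  (∀ (a c : (SP.Qm 0) × (SP.Qp 1)) (b : (SP.Qp 0) × (SP.Qm 1)),
    ((KPc.tp a b c).1 : Pm)
      = KP.tm a.1 b.1 c.1 - KP.tm b.2 a.2 c.1 + (KP.tm a.1 c.2 b.2 - KP.tm b.2 c.2 a.1) ∧
    ((KPc.tp a b c).2 : Pp)
      = KP.tp a.2 b.2 c.2 - KP.tp b.1 a.1 c.2 + (KP.tp a.2 c.1 b.1 - KP.tp b.1 c.1 a.2)) ∧
  (∀ (a c : (SP.Qp 0) × (SP.Qm 1)) (b : (SP.Qm 0) × (SP.Qp 1)),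
    ((KPc.tm a b c).1 : Pp)
      = KP.tp a.1 b.1 c.1 - KP.tp b.2 a.2 c.1 + (KP.tp a.1 c.2 b.2 - KP.tp b.2 c.2 a.1) ∧
    ((KPc.tm a b c).2 : Pm)
      = KP.tm a.2 b.2 c.2 - KP.tm b.1 a.1 c.2 + (KP.tm a.2 c.1 b.1 - KP.tm b.1 c.1 a.2))

universe u v w

/-- A simple 5-graded Lie algebra enveloping the Kantor pair `KP`. -/
structure SimpleEnvelope {K : Type u} [CommRing K] {Pm : Type v} {Pp : Type w}
    [AddCommGroup Pm] [AddCommGroup Pp] [Module K Pm] [Module K Pp]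
    (KP : KantorPair K Pm Pp) where
  L : Type (max u v w)
  [lieRing : LieRing L]
  [lieAlgebra : LieAlgebra K L]
  fg : FiveGrading K L
  env : Envelops KP fg
  simple : LieAlgebra.IsSimple K L


section Grading

variable {K : Type*} [CommRing K]

theorem isInternal_five {M : Type*} [AddCommGroup M] [Module K M] (g : ℤ → Submodule K M)
    (van : ∀ i : ℤ, 2 < |i| → g i = ⊥)
    (ex : ∀ x : M, ∃ a ∈ g (-2), ∃ b ∈ g (-1), ∃ c ∈ g 0, ∃ d ∈ g 1, ∃ e ∈ g 2,
      x = a + b + c + d + e)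
    (un : ∀ a ∈ g (-2), ∀ b ∈ g (-1), ∀ c ∈ g 0, ∀ d ∈ g 1, ∀ e ∈ g 2,
      a + b + c + d + e = 0 → a = 0 ∧ b = 0 ∧ c = 0 ∧ d = 0 ∧ e = 0) :
    DirectSum.IsInternal g := by
  classical
  rw [DirectSum.isInternal_submodule_iff_iSupIndep_and_iSup_eq_top]
  constructor
  · rw [iSupIndep_iff_finsetSum_eq_zero_imp_eq_zero]
    intro s v hv hs
    have key : ∀ i, (if i ∈ s then v i else 0) ∈ g i := by
      intro i
      split_ifs with h
      · exact hv i h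
      · exact zero_mem _
    have h0 : ∑ i ∈ ({-2, -1, 0, 1, 2} : Finset ℤ), (if i ∈ s then v i else 0) = 0 := by
      rw [Finset.sum_ite_mem]
      refine Eq.trans ?_ hs
      apply Finset.sum_subset Finset.inter_subset_right
      intro i hi hi'
      have h1 := hv i hi
      rw [van i, Submodule.mem_bot] at h1
      · exact h1
      · by_contra hc
        apply hi'
        rw [Finset.mem_inter]
        refine ⟨?_, hi⟩
        rw [not_lt, abs_le] at hc
        simp only [Finset.mem_insert, Finset.mem_singleton]
        omega
    have h1 := un _ (key (-2)) _ (key (-1)) _ (key 0) _ (key 1) _ (key 2) (by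
      rw [Finset.sum_insert (by decide), Finset.sum_insert (by decide),
        Finset.sum_insert (by decide), Finset.sum_insert (by decide), Finset.sum_singleton] at h0
      simpa only [add_assoc] using h0)
    obtain ⟨h1, h2, h3, h4, h5⟩ := h1
    intro i hi
    by_cases hc : 2 < |i|
    · have h6 := hv i hi
      rwa [van i hc, Submodule.mem_bot] at h6
    · rw [not_lt, abs_le] at hc
      have : i = -2 ∨ i = -1 ∨ i = 0 ∨ i = 1 ∨ i = 2 := by omega
      rcases this with rfl | rfl | rfl | rfl | rfl
      · rwa [if_pos hi] at h1
      · rwa [if_pos hi] at h2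
      · rwa [if_pos hi] at h3
      · rwa [if_pos hi] at h4
      · rwa [if_pos hi] at h5
  · rw [eq_top_iff]
    intro x _
    obtain ⟨a, ha, b, hb, c, hc, d, hd, e, he, rfl⟩ := ex x
    have := fun i => le_iSup g i
    exact add_mem (add_mem (add_mem (add_mem (this _ ha) (this _ hb)) (this _ hc)) (this _ hd))
      (this _ he)

variable {L : Type*} [LieRing L] [LieAlgebra K L]

namespace FiveGrading

/-- Projection on the homogeneous component. -/
noncomputable def pr (fg : FiveGrading K L) (i : ℤ) : L →ₗ[K] L :=
  (fg.g i).subtype ∘ₗ DirectSum.component K ℤ (fun i => fg.g i) i ∘ₗ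
    (LinearEquiv.ofBijective (DirectSum.coeLinearMap fg.g) fg.internal).symm.toLinearMap

variable (fg : FiveGrading K L)

theorem pr_mem (i : ℤ) (x : L) : fg.pr i x ∈ fg.g i := by
  simp [pr]

theorem pr_of_mem {i : ℤ} {x : L} (hx : x ∈ fg.g i) : fg.pr i x = x := by
  simp only [pr, LinearMap.comp_apply]
  exact congrArg Subtype.val (fg.internal.ofBijective_coeLinearMap_of_mem hx)

theorem pr_of_mem_ne {i j : ℤ} (hij : i ≠ j) {x : L} (hx : x ∈ fg.g i) : fg.pr j x = 0 := by
  simp only [pr, LinearMap.comp_apply]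
  exact congrArg Subtype.val (fg.internal.ofBijective_coeLinearMap_of_mem_ne hij hx)

theorem pr_vanish {i : ℤ} (hi : 2 < |i|) (x : L) : fg.pr i x = 0 := by
  have := fg.pr_mem i x
  rwa [fg.vanish i hi, Submodule.mem_bot] at this

theorem hom_induction {p : L → Prop} (x : L) (h : ∀ i, ∀ x ∈ fg.g i, p x)
    (h0 : p 0) (hadd : ∀ x y, p x → p y → p (x + y)) : p x := by
  have : x ∈ iSup fg.g := by rw [fg.internal.submodule_iSup_eq_top]; trivial
  exact Submodule.iSup_induction fg.g (motive := p) this h h0 hadd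

theorem sum_pr (x : L) :
    x = fg.pr (-2) x + fg.pr (-1) x + fg.pr 0 x + fg.pr 1 x + fg.pr 2 x := by
  induction x using fg.hom_induction with
  | h i x hx =>
    by_cases hc : 2 < |i|
    · rw [fg.vanish i hc, Submodule.mem_bot] at hx
      simp [hx]
    · rw [not_lt, abs_le] at hc
      have : i = -2 ∨ i = -1 ∨ i = 0 ∨ i = 1 ∨ i = 2 := by omega
      rcases this with rfl | rfl | rfl | rfl | rfl
      · rw [fg.pr_of_mem hx, fg.pr_of_mem_ne (j := -1) (by norm_num) hx,
          fg.pr_of_mem_ne (j := 0) (by norm_num) hx, fg.pr_of_mem_ne (j := 1) (by norm_num) hx,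
          fg.pr_of_mem_ne (j := 2) (by norm_num) hx]; simp
      · rw [fg.pr_of_mem hx, fg.pr_of_mem_ne (j := -2) (by norm_num) hx,
          fg.pr_of_mem_ne (j := 0) (by norm_num) hx, fg.pr_of_mem_ne (j := 1) (by norm_num) hx,
          fg.pr_of_mem_ne (j := 2) (by norm_num) hx]; simp
      · rw [fg.pr_of_mem hx, fg.pr_of_mem_ne (j := -2) (by norm_num) hx,
          fg.pr_of_mem_ne (j := -1) (by norm_num) hx, fg.pr_of_mem_ne (j := 1) (by norm_num) hx,
          fg.pr_of_mem_ne (j := 2) (by norm_num) hx]; simp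
      · rw [fg.pr_of_mem hx, fg.pr_of_mem_ne (j := -2) (by norm_num) hx,
          fg.pr_of_mem_ne (j := -1) (by norm_num) hx, fg.pr_of_mem_ne (j := 0) (by norm_num) hx,
          fg.pr_of_mem_ne (j := 2) (by norm_num) hx]; simp
      · rw [fg.pr_of_mem hx, fg.pr_of_mem_ne (j := -2) (by norm_num) hx,
          fg.pr_of_mem_ne (j := -1) (by norm_num) hx, fg.pr_of_mem_ne (j := 0) (by norm_num) hx,
          fg.pr_of_mem_ne (j := 1) (by norm_num) hx]; simp
  | h0 => simp
  | hadd x y hx hy =>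
    simp only [map_add]
    nth_rewrite 1 [hx, hy]
    abel

theorem pr_lie {i j k : ℤ} (hk : j + i = k) {a : L} (ha : a ∈ fg.g j) (x : L) :
    fg.pr k ⁅a, x⁆ = ⁅a, fg.pr i x⁆ := by
  induction x using fg.hom_induction with
  | h l x hx =>
    by_cases hl : l = i
    · subst hl
      rw [fg.pr_of_mem hx, fg.pr_of_mem]
      rw [← hk]; exact fg.lie_mem _ _ _ _ ha hx
    · rw [fg.pr_of_mem_ne hl hx, lie_zero]
      exact fg.pr_of_mem_ne (by omega) (fg.lie_mem _ _ _ _ ha hx)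
  | h0 => simp
  | hadd x y hx hy => simp [hx, hy]

theorem lie_mem' {i j k : ℤ} (hk : i + j = k) {a b : L} (ha : a ∈ fg.g i) (hb : b ∈ fg.g j) :
    ⁅a, b⁆ ∈ fg.g k := hk ▸ fg.lie_mem i j a b ha hb

theorem lie_zero' {i j : ℤ} (hk : 2 < |i + j|) {a b : L} (ha : a ∈ fg.g i) (hb : b ∈ fg.g j) :
    ⁅a, b⁆ = 0 := by
  have := fg.lie_mem i j a b ha hb
  rwa [fg.vanish _ hk, Submodule.mem_bot] at this

/-- Submodule of elements acting from `A` into `B` -/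
def nrm (Am Ap Bm Bp : Submodule K L) : Submodule K L where
  carrier := {z | fg.pr (-1) z ∈ Bm ∧ fg.pr 1 z ∈ Bp ∧
    (∀ a ∈ Am, ⁅fg.pr 0 z, a⁆ ∈ Bm) ∧ (∀ a ∈ Ap, ⁅fg.pr 0 z, a⁆ ∈ Bp) ∧
    (∀ a ∈ Am, ⁅fg.pr 2 z, a⁆ ∈ Bp) ∧ (∀ a ∈ Ap, ⁅fg.pr (-2) z, a⁆ ∈ Bm)}
  zero_mem' := by simp
  add_mem' := by
    rintro x y ⟨h1, h2, h3, h4, h5, h6⟩ ⟨h1', h2', h3', h4', h5', h6'⟩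
    simp only [Set.mem_ofPred_eq, map_add, add_lie]
    exact ⟨add_mem h1 h1', add_mem h2 h2', fun a ha => add_mem (h3 a ha) (h3' a ha),
      fun a ha => add_mem (h4 a ha) (h4' a ha), fun a ha => add_mem (h5 a ha) (h5' a ha),
      fun a ha => add_mem (h6 a ha) (h6' a ha)⟩
  smul_mem' := by
    rintro c x ⟨h1, h2, h3, h4, h5, h6⟩
    simp only [Set.mem_ofPred_eq, map_smul, smul_lie]
    exact ⟨Submodule.smul_mem _ _ h1, Submodule.smul_mem _ _ h2,
      fun a ha => Submodule.smul_mem _ _ (h3 a ha),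
      fun a ha => Submodule.smul_mem _ _ (h4 a ha), fun a ha => Submodule.smul_mem _ _ (h5 a ha),
      fun a ha => Submodule.smul_mem _ _ (h6 a ha)⟩

/-- The triple product condition for `B` with respect to `A`. -/
structure TripleCond (Am Ap Bm Bp : Submodule K L) : Prop where
  m1 : ∀ a ∈ Am, ∀ b ∈ Bp, ∀ c ∈ Am, ⁅⁅a, b⁆, c⁆ ∈ Bm
  m2 : ∀ b ∈ Bm, ∀ a ∈ Ap, ∀ c ∈ Am, ⁅⁅b, a⁆, c⁆ ∈ Bm
  m3 : ∀ a ∈ Am, ∀ c ∈ Ap, ∀ b ∈ Bm, ⁅⁅a, c⁆, b⁆ ∈ Bm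
  p1 : ∀ a ∈ Ap, ∀ b ∈ Bm, ∀ c ∈ Ap, ⁅⁅a, b⁆, c⁆ ∈ Bp
  p2 : ∀ b ∈ Bp, ∀ a ∈ Am, ∀ c ∈ Ap, ⁅⁅b, a⁆, c⁆ ∈ Bp
  p3 : ∀ a ∈ Ap, ∀ c ∈ Am, ∀ b ∈ Bp, ⁅⁅a, c⁆, b⁆ ∈ Bp

variable {fg} {Am Ap Bm Bp : Submodule K L}

theorem nrm_lie_p (hAp : Ap ≤ fg.g 1) (H : TripleCond Am Ap Bm Bp) {a z : L} (ha : a ∈ Ap)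
    (hz : z ∈ fg.nrm Am Ap Bm Bp) : ⁅a, z⁆ ∈ fg.nrm Am Ap Bm Bp := by
  obtain ⟨h1, h2, h3, h4, h5, h6⟩ := hz
  have ha1 := hAp ha
  refine ⟨?_, ?_, ?_, ?_, ?_, ?_⟩
  · rw [fg.pr_lie (i := -2) (by norm_num) ha1, ← lie_skew]
    exact neg_mem (h6 a ha)
  · rw [fg.pr_lie (i := 0) (by norm_num) ha1, ← lie_skew]
    exact neg_mem (h4 a ha)
  · intro c hc
    rw [fg.pr_lie (i := -1) (by norm_num) ha1, ← lie_skew a, neg_lie]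
    exact neg_mem (H.m2 _ h1 a ha c hc)
  · intro c hc
    rw [fg.pr_lie (i := -1) (by norm_num) ha1]
    exact H.p1 _ ha _ h1 c hc
  · intro c hc
    rw [fg.pr_lie (i := 1) (by norm_num) ha1, lie_lie, ← lie_skew a ⁅_, _⁆, ← lie_skew (fg.pr 1 z) ⁅_, _⁆,
      sub_neg_eq_add]
    exact add_mem (neg_mem (H.p2 _ h2 c hc a ha)) (H.p3 a ha c hc _ h2)
  · intro c hc
    rw [fg.pr_lie (i := -3) (by norm_num) ha1, fg.pr_vanish (by norm_num)]
    simp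

theorem nrm_lie_m (hAm : Am ≤ fg.g (-1)) (H : TripleCond Am Ap Bm Bp) {a z : L} (ha : a ∈ Am)
    (hz : z ∈ fg.nrm Am Ap Bm Bp) : ⁅a, z⁆ ∈ fg.nrm Am Ap Bm Bp := by
  obtain ⟨h1, h2, h3, h4, h5, h6⟩ := hz
  have ha1 := hAm ha
  refine ⟨?_, ?_, ?_, ?_, ?_, ?_⟩
  · rw [fg.pr_lie (i := 0) (by norm_num) ha1, ← lie_skew]
    exact neg_mem (h3 a ha)
  · rw [fg.pr_lie (i := 2) (by norm_num) ha1, ← lie_skew]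
    exact neg_mem (h5 a ha)
  · intro c hc
    rw [fg.pr_lie (i := 1) (by norm_num) ha1]
    exact H.m1 _ ha _ h2 c hc
  · intro c hc
    rw [fg.pr_lie (i := 1) (by norm_num) ha1, ← lie_skew a, neg_lie]
    exact neg_mem (H.p2 _ h2 a ha c hc)
  · intro c hc
    rw [fg.pr_lie (i := 3) (by norm_num) ha1, fg.pr_vanish (by norm_num)]
    simp
  · intro c hc
    rw [fg.pr_lie (i := -1) (by norm_num) ha1, lie_lie, ← lie_skew a ⁅_, _⁆, ← lie_skew (fg.pr (-1) z) ⁅_, _⁆,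
      sub_neg_eq_add]
    exact add_mem (neg_mem (H.m2 _ h1 c hc a ha)) (H.m3 a ha c hc _ h1)

theorem mem_nrm_of_m {b : L} (hb : b ∈ fg.g (-1)) (hb' : b ∈ Bm) :
    b ∈ fg.nrm Am Ap Bm Bp := by
  refine ⟨?_, ?_, ?_, ?_, ?_, ?_⟩
  · rwa [fg.pr_of_mem hb]
  all_goals rw [fg.pr_of_mem_ne (by norm_num) hb]
  all_goals simp

theorem mem_nrm_of_p {b : L} (hb : b ∈ fg.g 1) (hb' : b ∈ Bp) :
    b ∈ fg.nrm Am Ap Bm Bp := by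
  refine ⟨?_, ?_, ?_, ?_, ?_, ?_⟩
  rotate_left
  · rwa [fg.pr_of_mem hb]
  all_goals rw [fg.pr_of_mem_ne (by norm_num) hb]
  all_goals simp

variable (fg)

/-- A submodule stable under the generators is stable under everything. -/
theorem stable_of_gen (hgen : LieSubalgebra.lieSpan K L ↑(Tsub fg) = ⊤) (N : Submodule K L)
    (hm : ∀ a ∈ fg.g (-1), ∀ z ∈ N, ⁅a, z⁆ ∈ N) (hp : ∀ a ∈ fg.g 1, ∀ z ∈ N, ⁅a, z⁆ ∈ N)
    (x : L) : ∀ z ∈ N, ⁅x, z⁆ ∈ N := by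
  have hx : x ∈ LieSubalgebra.lieSpan K L (Tsub fg : Set L) := by rw [hgen]; trivial
  induction hx using LieSubalgebra.lieSpan_induction with
  | mem x h =>
    obtain ⟨a, ha, b, hb, rfl⟩ := Submodule.mem_sup.1 h
    intro z hz
    rw [add_lie]
    exact add_mem (hm a ha z hz) (hp b hb z hz)
  | zero => simp
  | add x y _ _ hx hy =>
    intro z hz
    rw [add_lie]
    exact add_mem (hx z hz) (hy z hz)
  | smul c x _ hx =>
    intro z hz
    rw [smul_lie]
    exact Submodule.smul_mem _ _ (hx z hz)
  | lie x y _ _ hx hy =>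
    intro z hz
    rw [lie_lie]
    exact sub_mem (hx _ (hy z hz)) (hy _ (hx z hz))

theorem top_of_gen (hgen : LieSubalgebra.lieSpan K L ↑(Tsub fg) = ⊤) (N : Submodule K L)
    (hm : ∀ a ∈ fg.g (-1), ∀ z ∈ N, ⁅a, z⁆ ∈ N) (hp : ∀ a ∈ fg.g 1, ∀ z ∈ N, ⁅a, z⁆ ∈ N)
    (hm' : fg.g (-1) ≤ N) (hp' : fg.g 1 ≤ N)
    (x : L) : x ∈ N := by
  have hx : x ∈ LieSubalgebra.lieSpan K L (Tsub fg : Set L) := by rw [hgen]; trivial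
  induction hx using LieSubalgebra.lieSpan_induction with
  | mem x h => exact (sup_le hm' hp') h
  | zero => simp
  | add x y _ _ hx hy => exact add_mem hx hy
  | smul c x _ hx => exact Submodule.smul_mem _ _ hx
  | lie x y _ _ hx hy => exact fg.stable_of_gen hgen N hm hp x y hy

/-- Elements commuting with the generators are central. -/
theorem central_of_gen (hgen : LieSubalgebra.lieSpan K L ↑(Tsub fg) = ⊤) {z : L}
    (hm : ∀ a ∈ fg.g (-1), ⁅z, a⁆ = 0) (hp : ∀ a ∈ fg.g 1, ⁅z, a⁆ = 0)
    (x : L) : ⁅z, x⁆ = 0 := by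
  have hx : x ∈ LieSubalgebra.lieSpan K L (Tsub fg : Set L) := by rw [hgen]; trivial
  induction hx using LieSubalgebra.lieSpan_induction with
  | mem x h =>
    obtain ⟨a, ha, b, hb, rfl⟩ := Submodule.mem_sup.1 h
    rw [lie_add, hm a ha, hp b hb, add_zero]
  | zero => simp
  | add x y _ _ hx hy => rw [lie_add, hx, hy, add_zero]
  | smul c x _ hx => rw [lie_smul, hx, smul_zero]
  | lie x y _ _ hx hy => rw [leibniz_lie, hx, hy]; simp

theorem brk_decomp (hgen : LieSubalgebra.lieSpan K L ↑(Tsub fg) = ⊤) (x : L) :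
    fg.pr (-2) x ∈ brkSpan K (fg.g (-1)) (fg.g (-1)) ∧
    fg.pr 0 x ∈ brkSpan K (fg.g (-1)) (fg.g 1) ∧
    fg.pr 2 x ∈ brkSpan K (fg.g 1) (fg.g 1) := by
  let N : Submodule K L := (brkSpan K (fg.g (-1)) (fg.g (-1))).comap (fg.pr (-2)) ⊓
    ((brkSpan K (fg.g (-1)) (fg.g 1)).comap (fg.pr 0) ⊓
    (brkSpan K (fg.g 1) (fg.g 1)).comap (fg.pr 2))
  have : x ∈ N := by
    apply fg.top_of_gen hgen
    · intro a ha z hz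
      refine ⟨?_, ?_, ?_⟩ <;> simp only [SetLike.mem_coe, Submodule.mem_comap]
      · rw [fg.pr_lie (i := -1) (by norm_num) ha]
        exact Submodule.subset_span ⟨_, ha, _, fg.pr_mem _ _, rfl⟩
      · rw [fg.pr_lie (i := 1) (by norm_num) ha]
        exact Submodule.subset_span ⟨_, ha, _, fg.pr_mem _ _, rfl⟩
      · rw [fg.pr_lie (i := 3) (by norm_num) ha, fg.pr_vanish (by norm_num)]
        simp
    · intro a ha z hz
      refine ⟨?_, ?_, ?_⟩ <;> simp only [SetLike.mem_coe, Submodule.mem_comap]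
      · rw [fg.pr_lie (i := -3) (by norm_num) ha, fg.pr_vanish (by norm_num)]
        simp
      · rw [fg.pr_lie (i := -1) (by norm_num) ha, ← lie_skew]
        exact neg_mem (Submodule.subset_span ⟨_, fg.pr_mem _ _, _, ha, rfl⟩)
      · rw [fg.pr_lie (i := 1) (by norm_num) ha]
        exact Submodule.subset_span ⟨_, ha, _, fg.pr_mem _ _, rfl⟩
    · intro a ha
      refine ⟨?_, ?_, ?_⟩ <;> simp only [SetLike.mem_coe, Submodule.mem_comap] <;>
      rw [fg.pr_of_mem_ne (by norm_num) ha] <;> simp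
    · intro a ha
      refine ⟨?_, ?_, ?_⟩ <;> simp only [SetLike.mem_coe, Submodule.mem_comap] <;>
      rw [fg.pr_of_mem_ne (by norm_num) ha] <;> simp
  exact this

theorem brk_mono {U V U' V' : Submodule K L} (h : U ≤ U') (h' : V ≤ V') :
    brkSpan K U V ≤ brkSpan K U' V' := by
  apply Submodule.span_mono
  rintro _ ⟨x, hx, y, hy, rfl⟩
  exact ⟨x, h hx, y, h' hy, rfl⟩

/-- Faithfulness for tight envelopes -/
theorem faithful (ht : Tight K fg) {i : ℤ} (hi : i = -2 ∨ i = 0 ∨ i = 2) {z : L}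
    (hz : z ∈ fg.g i)
    (hm : ∀ a ∈ fg.g (-1), ⁅z, a⁆ = 0) (hp : ∀ a ∈ fg.g 1, ⁅z, a⁆ = 0) : z = 0 := by
  apply ht.2 z _ (fg.central_of_gen ht.1 hm hp)
  obtain ⟨h1, h2, h3⟩ := fg.brk_decomp ht.1 z
  have hM : fg.g (-1) ≤ Tsub fg := le_sup_left
  have hP : fg.g 1 ≤ Tsub fg := le_sup_right
  rcases hi with rfl | rfl | rfl
  · rw [fg.pr_of_mem hz] at h1
    exact brk_mono hM hM h1
  · rw [fg.pr_of_mem hz] at h2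
    exact brk_mono hM hP h2
  · rw [fg.pr_of_mem hz] at h3
    exact brk_mono hP hP h3

end FiveGrading

end Grading

section Envelope

variable {K : Type*} [CommRing K] {Pm Pp : Type*}
  [AddCommGroup Pm] [AddCommGroup Pp] [Module K Pm] [Module K Pp]
  {KP : KantorPair K Pm Pp} {L : Type*} [LieRing L] [LieAlgebra K L] {fg : FiveGrading K L}

namespace Envelops

theorem em_mem (E : Envelops KP fg) (x : Pm) : E.em x ∈ fg.g (-1) := by
  rw [← E.range_m]; exact ⟨x, rfl⟩

theorem ep_mem (E : Envelops KP fg) (x : Pp) : E.ep x ∈ fg.g 1 := by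
  rw [← E.range_p]; exact ⟨x, rfl⟩

theorem exists_m (E : Envelops KP fg) {a : L} (h : a ∈ fg.g (-1)) : ∃ x, E.em x = a := by
  rw [← E.range_m] at h; exact h

theorem exists_p (E : Envelops KP fg) {a : L} (h : a ∈ fg.g 1) : ∃ x, E.ep x = a := by
  rw [← E.range_p] at h; exact h

/-- A simple envelope is tight. -/
theorem tight_of_simple (E : Envelops KP fg) (hs : LieAlgebra.IsSimple K L)
    (hnz : (∃ x : Pm, x ≠ 0) ∨ (∃ x : Pp, x ≠ 0)) : Tight K fg := by
  constructor
  · set M := LieSubalgebra.lieSpan K L (Tsub fg : Set L) with hM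
    have hTm : ∀ a ∈ fg.g (-1), a ∈ M := fun a ha =>
      LieSubalgebra.subset_lieSpan ((le_sup_left : fg.g (-1) ≤ Tsub fg) ha)
    have hTp : ∀ a ∈ fg.g 1, a ∈ M := fun a ha =>
      LieSubalgebra.subset_lieSpan ((le_sup_right : fg.g 1 ≤ Tsub fg) ha)
    have stab : ∀ i, ∀ x ∈ fg.g i, ∀ m ∈ M, ⁅x, m⁆ ∈ M := by
      intro i x hx m hm
      by_cases hi : i = -1
      · subst hi
        exact M.lie_mem (hTm x hx) hm
      by_cases hi' : i = 1
      · subst hi'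
        exact M.lie_mem (hTp x hx) hm
      induction hm using LieSubalgebra.lieSpan_induction with
      | mem y hy =>
        obtain ⟨a, ha, b, hb, rfl⟩ := Submodule.mem_sup.1 hy
        rw [lie_add]
        by_cases h2 : 2 < |i|
        · rw [fg.vanish i h2, Submodule.mem_bot] at hx
          subst hx
          simp
        rw [not_lt, abs_le] at h2
        have : i = -2 ∨ i = 0 ∨ i = 2 := by omega
        rcases this with rfl | rfl | rfl
        · rw [fg.lie_zero' (by norm_num) hx ha, zero_add]
          exact hTm _ (fg.lie_mem' (by norm_num) hx hb)
        · exact add_mem (hTm _ (fg.lie_mem' (by norm_num) hx ha))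
            (hTp _ (fg.lie_mem' (by norm_num) hx hb))
        · rw [fg.lie_zero' (by norm_num) hx hb, add_zero]
          exact hTp _ (fg.lie_mem' (by norm_num) hx ha)
      | zero => simp
      | add y z _ _ hy hz => rw [lie_add]; exact add_mem hy hz
      | smul c y _ hy => rw [lie_smul]; exact M.smul_mem c hy
      | lie y z hy' hz' hy hz =>
        rw [leibniz_lie]
        exact add_mem (M.lie_mem hy hz') (M.lie_mem hy' hz)
    let I : LieIdeal K L := { M.toSubmodule with
      lie_mem := by
        intro x m hm
        have hm' : m ∈ M := hm
        show ⁅x, m⁆ ∈ M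
        induction x using fg.hom_induction with
        | h i x hx => exact stab i x hx m hm'
        | h0 => simp
        | hadd x y hx hy => rw [add_lie]; exact add_mem hx hy }
    have hI : ∀ x, x ∈ I ↔ x ∈ M := fun x => Iff.rfl
    rcases hs.eq_bot_or_eq_top I with h | h
    · exfalso
      rcases hnz with ⟨x, hx⟩ | ⟨x, hx⟩
      · apply hx
        have := (hI _).2 (hTm _ (E.em_mem x))
        rw [h, LieSubmodule.mem_bot] at this
        exact E.inj_m (by rw [this, map_zero])
      · apply hx
        have := (hI _).2 (hTp _ (E.ep_mem x))
        rw [h, LieSubmodule.mem_bot] at this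
        exact E.inj_p (by rw [this, map_zero])
    · rw [eq_top_iff]
      intro x _
      rw [← hI, h]
      trivial
  · intro z _ hz
    have h1 : z ∈ LieAlgebra.center K L := by
      rw [LieModule.mem_maxTrivSubmodule]
      intro x
      rw [← lie_skew, hz, neg_zero]
    rwa [LieAlgebra.center_eq_bot K L, LieSubmodule.mem_bot] at h1

theorem triple_range (E : Envelops KP fg) {Qm : Submodule K Pm} {Qp : Submodule K Pp}
    (hQ : KP.IsIdealPair Qm Qp) :
    FiveGrading.TripleCond (fg.g (-1)) (fg.g 1) (Qm.map E.em) (Qp.map E.ep) where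
  m1 := by
    rintro a ha _ ⟨q, hq, rfl⟩ c hc
    obtain ⟨a, rfl⟩ := E.exists_m ha
    obtain ⟨c, rfl⟩ := E.exists_m hc
    rw [← E.compat_m]
    exact ⟨_, hQ.2.1 a c q hq, rfl⟩
  m2 := by
    rintro _ ⟨q, hq, rfl⟩ a ha c hc
    obtain ⟨a, rfl⟩ := E.exists_p ha
    obtain ⟨c, rfl⟩ := E.exists_m hc
    rw [← E.compat_m]
    exact ⟨_, (hQ.1 0 c a q hq).2, rfl⟩
  m3 := by
    rintro a ha c hc _ ⟨q, hq, rfl⟩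
    obtain ⟨a, rfl⟩ := E.exists_m ha
    obtain ⟨c, rfl⟩ := E.exists_p hc
    rw [← E.compat_m]
    exact ⟨_, (hQ.1 a 0 c q hq).1, rfl⟩
  p1 := by
    rintro a ha _ ⟨q, hq, rfl⟩ c hc
    obtain ⟨a, rfl⟩ := E.exists_p ha
    obtain ⟨c, rfl⟩ := E.exists_p hc
    rw [← E.compat_p]
    exact ⟨_, hQ.2.2.2 a c q hq, rfl⟩
  p2 := by
    rintro _ ⟨q, hq, rfl⟩ a ha c hc
    obtain ⟨a, rfl⟩ := E.exists_m ha
    obtain ⟨c, rfl⟩ := E.exists_p hc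
    rw [← E.compat_p]
    exact ⟨_, (hQ.2.2.1 0 c a q hq).2, rfl⟩
  p3 := by
    rintro a ha c hc _ ⟨q, hq, rfl⟩
    obtain ⟨a, rfl⟩ := E.exists_p ha
    obtain ⟨c, rfl⟩ := E.exists_m hc
    rw [← E.compat_p]
    exact ⟨_, (hQ.2.2.1 a 0 c q hq).1, rfl⟩

theorem pair_simple (E : Envelops KP fg) (hs : LieAlgebra.IsSimple K L)
    (hnz : (∃ x : Pm, x ≠ 0) ∨ (∃ x : Pp, x ≠ 0)) : KP.IsSimplePair := by
  have ht := E.tight_of_simple hs hnz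
  constructor
  · by_contra hc
    push Not at hc
    obtain ⟨hm, hp⟩ := hc
    have h0 : ∀ x y, ⁅E.em x, E.ep y⁆ = 0 := by
      intro x y
      apply fg.faithful ht (i := 0) (by simp) (fg.lie_mem' (by norm_num) (E.em_mem x) (E.ep_mem y))
      · intro a ha
        obtain ⟨a, rfl⟩ := E.exists_m ha
        rw [← E.compat_m, hm, map_zero]
      · intro a ha
        obtain ⟨a, rfl⟩ := E.exists_p ha
        rw [← lie_skew (E.em x), neg_lie, ← E.compat_p, hp, map_zero, neg_zero]
    have h0' : ∀ x y, ⁅E.ep y, E.em x⁆ = 0 := by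
      intro x y
      rw [← lie_skew, h0, neg_zero]
    have h1 : ∀ x y, ⁅E.em x, E.em y⁆ = 0 := by
      intro x y
      apply fg.faithful ht (i := -2) (by simp)
        (fg.lie_mem' (by norm_num) (E.em_mem x) (E.em_mem y))
      · intro a ha
        exact fg.lie_zero' (i := -2) (j := -1) (by norm_num)
          (fg.lie_mem' (by norm_num) (E.em_mem x) (E.em_mem y)) ha
      · intro a ha
        obtain ⟨a, rfl⟩ := E.exists_p ha
        rw [lie_lie, h0, h0, lie_zero, lie_zero, sub_zero]
    have h2 : ∀ x y, ⁅E.ep x, E.ep y⁆ = 0 := by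
      intro x y
      apply fg.faithful ht (i := 2) (by simp)
        (fg.lie_mem' (by norm_num) (E.ep_mem x) (E.ep_mem y))
      · intro a ha
        obtain ⟨a, rfl⟩ := E.exists_m ha
        rw [lie_lie, h0', h0', lie_zero, lie_zero, sub_zero]
      · intro a ha
        exact fg.lie_zero' (i := 2) (j := 1) (by norm_num)
          (fg.lie_mem' (by norm_num) (E.ep_mem x) (E.ep_mem y)) ha
    have key : ∀ z : L, (∀ a ∈ fg.g (-1), ⁅z, a⁆ = 0) → (∀ a ∈ fg.g 1, ⁅z, a⁆ = 0) → z = 0 := by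
      intro z h h'
      have h1 : z ∈ LieAlgebra.center K L := by
        rw [LieModule.mem_maxTrivSubmodule]
        intro x
        rw [← lie_skew, fg.central_of_gen ht.1 h h', neg_zero]
      rwa [LieAlgebra.center_eq_bot K L, LieSubmodule.mem_bot] at h1
    rcases hnz with ⟨x, hx⟩ | ⟨x, hx⟩
    · apply hx
      apply E.inj_m
      rw [map_zero]
      apply key
      · intro a ha
        obtain ⟨a, rfl⟩ := E.exists_m ha
        exact h1 _ _
      · intro a ha
        obtain ⟨a, rfl⟩ := E.exists_p ha
        exact h0 _ _
    · apply hx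
      apply E.inj_p
      rw [map_zero]
      apply key
      · intro a ha
        obtain ⟨a, rfl⟩ := E.exists_m ha
        exact h0' _ _
      · intro a ha
        obtain ⟨a, rfl⟩ := E.exists_p ha
        exact h2 _ _
  · intro Qm Qp hQ
    have H := E.triple_range hQ
    let I : LieIdeal K L := { fg.nrm (fg.g (-1)) (fg.g 1) (Qm.map E.em) (Qp.map E.ep) with
      lie_mem := by
        intro x m hm
        exact fg.stable_of_gen ht.1 (fg.nrm (fg.g (-1)) (fg.g 1) (Qm.map E.em) (Qp.map E.ep))
          (fun a ha z hz => FiveGrading.nrm_lie_m le_rfl H ha hz)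
          (fun a ha z hz => FiveGrading.nrm_lie_p le_rfl H ha hz) x m hm }
    have hI : ∀ x, x ∈ I ↔ x ∈ fg.nrm (fg.g (-1)) (fg.g 1) (Qm.map E.em) (Qp.map E.ep) :=
      fun x => Iff.rfl
    rcases hs.eq_bot_or_eq_top I with h | h
    · left
      constructor
      · rw [eq_bot_iff]
        intro q hq
        have := (hI _).2 (FiveGrading.mem_nrm_of_m (E.em_mem q) ⟨q, hq, rfl⟩)
        rw [h, LieSubmodule.mem_bot] at this
        exact E.inj_m (by rw [this, map_zero])
      · rw [eq_bot_iff]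
        intro q hq
        have := (hI _).2 (FiveGrading.mem_nrm_of_p (E.ep_mem q) ⟨q, hq, rfl⟩)
        rw [h, LieSubmodule.mem_bot] at this
        exact E.inj_p (by rw [this, map_zero])
    · right
      constructor
      · rw [eq_top_iff]
        intro q _
        have h1 : E.em q ∈ I := by rw [h]; trivial
        have h2 := ((hI _).1 h1).1
        rw [fg.pr_of_mem (E.em_mem q)] at h2
        obtain ⟨q', hq', h3⟩ := h2
        rwa [← E.inj_m h3]
      · rw [eq_top_iff]
        intro q _
        have h1 : E.ep q ∈ I := by rw [h]; trivial
        have h2 := ((hI _).1 h1).2.1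
        rw [fg.pr_of_mem (E.ep_mem q)] at h2
        obtain ⟨q', hq', h3⟩ := h2
        rwa [← E.inj_p h3]

/-- The associated graded pieces of an ideal. -/
def gr (fg : FiveGrading K L) (I : LieIdeal K L) (i : ℤ) : Submodule K L where
  carrier := {a | ∃ x ∈ I, (∀ j < i, fg.pr j x = 0) ∧ fg.pr i x = a}
  zero_mem' := ⟨0, zero_mem _, by simp, by simp⟩
  add_mem' := by
    rintro _ _ ⟨x, hx, h, rfl⟩ ⟨y, hy, h', rfl⟩
    exact ⟨x + y, add_mem hx hy, fun j hj => by rw [map_add, h j hj, h' j hj, add_zero],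
      map_add _ _ _⟩
  smul_mem' := by
    rintro c _ ⟨x, hx, h, rfl⟩
    exact ⟨c • x, I.smul_mem c hx, fun j hj => by rw [map_smul, h j hj, smul_zero],
      map_smul _ _ _⟩

theorem gr_lie {I : LieIdeal K L} {i j k : ℤ} (hk : j + i = k) {a b : L} (ha : a ∈ gr fg I i)
    (hb : b ∈ fg.g j) : ⁅b, a⁆ ∈ gr fg I k := by
  obtain ⟨x, hx, h, rfl⟩ := ha
  refine ⟨⁅b, x⁆, lie_mem_right K L I b x hx, ?_, fg.pr_lie hk hb x⟩
  intro l hl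
  rw [fg.pr_lie (i := l - j) (by omega) hb, h _ (by omega), lie_zero]

/-- pairs of submodules of `L` stable under inner multiplication give ideal pairs. -/
theorem idealPair_of (E : Envelops KP fg) (A B C : Submodule K L)
    (hm : ∀ a ∈ fg.g (-1), (∀ z ∈ B, ⁅a, z⁆ ∈ A) ∧ (∀ z ∈ C, ⁅a, z⁆ ∈ B))
    (hp : ∀ a ∈ fg.g 1, (∀ z ∈ A, ⁅a, z⁆ ∈ B) ∧ (∀ z ∈ B, ⁅a, z⁆ ∈ C))
    (h0 : ∀ a ∈ fg.g 0, (∀ z ∈ A, ⁅a, z⁆ ∈ A) ∧ (∀ z ∈ C, ⁅a, z⁆ ∈ C)) :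
    KP.IsIdealPair (A.comap E.em) (C.comap E.ep) := by
  have hm := fun x => hm _ (E.em_mem x)
  have hp := fun x => hp _ (E.ep_mem x)
  refine ⟨?_, ?_, ?_, ?_⟩
  · intro x z y q hq
    simp only [Submodule.mem_comap] at hq ⊢
    rw [E.compat_m, E.compat_m]
    constructor
    · exact (h0 _ (fg.lie_mem' (by norm_num) (E.em_mem x) (E.ep_mem y))).1 _ hq
    · rw [← lie_skew, ← lie_skew (E.em q), lie_neg, neg_neg]
      exact (hm z).1 _ ((hp y).1 _ hq)
  · intro x z r hr
    simp only [Submodule.mem_comap] at hr ⊢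
    rw [E.compat_m, ← lie_skew]
    exact neg_mem ((hm z).1 _ ((hm x).2 _ hr))
  · intro x z y q hq
    simp only [Submodule.mem_comap] at hq ⊢
    rw [E.compat_p, E.compat_p]
    constructor
    · exact (h0 _ (fg.lie_mem' (by norm_num) (E.ep_mem x) (E.em_mem y))).2 _ hq
    · rw [← lie_skew, ← lie_skew (E.ep q), lie_neg, neg_neg]
      exact (hp z).2 _ ((hm y).2 _ hq)
  · intro x z r hr
    simp only [Submodule.mem_comap] at hr ⊢
    rw [E.compat_p, ← lie_skew]
    exact neg_mem ((hp z).2 _ ((hp x).1 _ hr))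

/-- A tight envelope of a simple Kantor pair is simple. -/
theorem simple_of_tight (E : Envelops KP fg) (ht : Tight K fg) (hP : KP.IsSimplePair) :
    LieAlgebra.IsSimple K L where
  non_abelian := by
    intro hab
    rcases hP.1 with ⟨x, y, z, h⟩ | ⟨x, y, z, h⟩
    · apply h
      apply E.inj_m
      rw [E.compat_m, trivial_lie_zero, map_zero]
    · apply h
      apply E.inj_p
      rw [E.compat_p, trivial_lie_zero, map_zero]
  eq_bot_or_eq_top := by
    intro I
    have hpp : ∃ p : Pp, p ≠ 0 := by
      by_contra hc
      push Not at hc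
      rcases hP.1 with ⟨x, y, z, h⟩ | ⟨x, y, z, h⟩
      · apply h
        apply E.inj_m
        rw [E.compat_m, hc y, map_zero, map_zero, lie_zero, zero_lie]
      · exact h (hc _)
    have hQ := E.idealPair_of (gr fg I (-1)) (gr fg I 0) (gr fg I 1)
      (fun a ha => ⟨fun z hz => gr_lie (by norm_num) hz ha,
        fun z hz => gr_lie (by norm_num) hz ha⟩)
      (fun a ha => ⟨fun z hz => gr_lie (by norm_num) hz ha,
        fun z hz => gr_lie (by norm_num) hz ha⟩)
      (fun a ha => ⟨fun z hz => gr_lie (by norm_num) hz ha,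
        fun z hz => gr_lie (by norm_num) hz ha⟩)
    have grsub : ∀ i, gr fg I i ≤ fg.g i := by
      rintro i _ ⟨x, _, _, rfl⟩
      exact fg.pr_mem i x
    rcases hP.2 _ _ hQ with ⟨hm, hp⟩ | ⟨hm, hp⟩
    · left
      have zm : ∀ a ∈ gr fg I (-1), a = 0 := by
        intro a ha
        obtain ⟨q, rfl⟩ := E.exists_m (grsub _ ha)
        have : q ∈ (gr fg I (-1)).comap E.em := ha
        rw [hm, Submodule.mem_bot] at this
        rw [this, map_zero]
      have zp : ∀ a ∈ gr fg I 1, a = 0 := by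
        intro a ha
        obtain ⟨q, rfl⟩ := E.exists_p (grsub _ ha)
        have : q ∈ (gr fg I 1).comap E.ep := ha
        rw [hp, Submodule.mem_bot] at this
        rw [this, map_zero]
      rw [eq_bot_iff]
      intro x hx
      rw [LieSubmodule.mem_bot]
      have l3 : ∀ j < (-2 : ℤ), fg.pr j x = 0 := fun j hj =>
        fg.pr_vanish (by rw [lt_abs]; omega) x
      have l2 : fg.pr (-2) x = 0 := by
        have hg : fg.pr (-2) x ∈ gr fg I (-2) := ⟨x, hx, l3, rfl⟩
        apply fg.faithful ht (i := -2) (by simp) (grsub _ hg)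
        · intro a ha
          exact fg.lie_zero' (by norm_num) (grsub _ hg) ha
        · intro a ha
          rw [← lie_skew, zm _ (gr_lie (by norm_num) hg ha), neg_zero]
      have l1 : fg.pr (-1) x = 0 := zm _ ⟨x, hx, fun j hj => by
        rcases (by omega : j = -2 ∨ j < -2) with rfl | h
        exacts [l2, l3 j h], rfl⟩
      have l1' : ∀ j < (0 : ℤ), fg.pr j x = 0 := fun j hj => by
        rcases (by omega : j = -1 ∨ j = -2 ∨ j < -2) with rfl | rfl | h
        exacts [l1, l2, l3 j h]
      have l0 : fg.pr 0 x = 0 := by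
        have hg : fg.pr 0 x ∈ gr fg I 0 := ⟨x, hx, l1', rfl⟩
        apply fg.faithful ht (i := 0) (by simp) (grsub _ hg)
        · intro a ha
          rw [← lie_skew, zm _ (gr_lie (by norm_num) hg ha), neg_zero]
        · intro a ha
          rw [← lie_skew, zp _ (gr_lie (by norm_num) hg ha), neg_zero]
      have l0' : ∀ j < (1 : ℤ), fg.pr j x = 0 := fun j hj => by
        rcases (by omega : j = 0 ∨ j < 0) with rfl | h
        exacts [l0, l1' j h]
      have k1 : fg.pr 1 x = 0 := zp _ ⟨x, hx, l0', rfl⟩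
      have k1' : ∀ j < (2 : ℤ), fg.pr j x = 0 := fun j hj => by
        rcases (by omega : j = 1 ∨ j < 1) with rfl | h
        exacts [k1, l0' j h]
      have k2 : fg.pr 2 x = 0 := by
        have hg : fg.pr 2 x ∈ gr fg I 2 := ⟨x, hx, k1', rfl⟩
        apply fg.faithful ht (i := 2) (by simp) (grsub _ hg)
        · intro a ha
          rw [← lie_skew, zp _ (gr_lie (by norm_num) hg ha), neg_zero]
        · intro a ha
          exact fg.lie_zero' (by norm_num) (grsub _ hg) ha
      rw [fg.sum_pr x, l2, l1, l0, k1, k2]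
      simp
    · right
      have hall : ∀ p ∈ fg.g 1, ∃ s ∈ fg.g 2, p + s ∈ I := by
        intro p hp1
        obtain ⟨p, rfl⟩ := E.exists_p hp1
        have : p ∈ (gr fg I 1).comap E.ep := by rw [hp]; trivial
        obtain ⟨x, hx, h, h'⟩ := this
        refine ⟨fg.pr 2 x, fg.pr_mem _ _, ?_⟩
        rw [← h']
        have h2 := fg.sum_pr x
        rw [h (-2) (by norm_num), h (-1) (by norm_num), h 0 (by norm_num)] at h2
        simp only [zero_add] at h2
        rwa [← h2]
      have h2I : ∀ s ∈ fg.g 2, s ∈ I := by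
        intro s hs
        have h1 := (fg.brk_decomp ht.1 s).2.2
        rw [fg.pr_of_mem hs] at h1
        have : brkSpan K (fg.g 1) (fg.g 1) ≤ I.toSubmodule := by
          apply Submodule.span_le.2
          rintro _ ⟨a, ha, b, hb, rfl⟩
          obtain ⟨s, hs, h⟩ := hall b hb
          have h3 := lie_mem_right K L I a _ h
          rw [lie_add, fg.lie_zero' (i := 1) (j := 2) (by norm_num) ha hs, add_zero] at h3
          exact h3
        exact this h1
      have h1I : ∀ p ∈ fg.g 1, p ∈ I := by
        intro p hp
        obtain ⟨s, hs, h⟩ := hall p hp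
        have := sub_mem h (h2I s hs)
        rwa [add_sub_cancel_right] at this
      have hQ' := E.idealPair_of I.toSubmodule I.toSubmodule I.toSubmodule
        (fun a ha => ⟨fun z hz => lie_mem_right K L I _ _ hz,
          fun z hz => lie_mem_right K L I _ _ hz⟩)
        (fun a ha => ⟨fun z hz => lie_mem_right K L I _ _ hz,
          fun z hz => lie_mem_right K L I _ _ hz⟩)
        (fun a ha => ⟨fun z hz => lie_mem_right K L I _ _ hz,
          fun z hz => lie_mem_right K L I _ _ hz⟩)
      rcases hP.2 _ _ hQ' with ⟨_, h⟩ | ⟨h, _⟩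
      · exfalso
        obtain ⟨p, hp0⟩ := hpp
        apply hp0
        have : p ∈ I.toSubmodule.comap E.ep := h1I _ (E.ep_mem p)
        rwa [h, Submodule.mem_bot] at this
      · rw [eq_top_iff]
        intro x _
        apply fg.top_of_gen ht.1 I.toSubmodule (fun a ha z hz => lie_mem_right K L I _ _ hz)
          (fun a ha z hz => lie_mem_right K L I _ _ hz)
        · intro a ha
          obtain ⟨q, rfl⟩ := E.exists_m ha
          have : q ∈ I.toSubmodule.comap E.em := by rw [h]; trivial
          exact this
        · exact h1I

end Envelops

end Envelope

section Iso

variable {K : Type*} [CommRing K] {Pm Pp : Type*}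
  [AddCommGroup Pm] [AddCommGroup Pp] [Module K Pm] [Module K Pp]
  {KP : KantorPair K Pm Pp} {L : Type*} [LieRing L] [LieAlgebra K L] {fg : FiveGrading K L}
  {L' : Type*} [LieRing L'] [LieAlgebra K L'] {fg' : FiveGrading K L'}

theorem FiveGrading.sum_zero (fg : FiveGrading K L) :
    ∀ a ∈ fg.g (-2), ∀ b ∈ fg.g (-1), ∀ c ∈ fg.g 0, ∀ d ∈ fg.g 1, ∀ e ∈ fg.g 2,
      a + b + c + d + e = 0 → a = 0 ∧ b = 0 ∧ c = 0 ∧ d = 0 ∧ e = 0 := by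
  intro a ha b hb c hc d hd e he h
  refine ⟨?_, ?_, ?_, ?_, ?_⟩
  · have h1 := congrArg (fg.pr (-2)) h
    simp only [map_add, map_zero] at h1
    rwa [fg.pr_of_mem ha, fg.pr_of_mem_ne (by norm_num) hb, fg.pr_of_mem_ne (by norm_num) hc,
      fg.pr_of_mem_ne (by norm_num) hd, fg.pr_of_mem_ne (by norm_num) he,
      add_zero, add_zero, add_zero, add_zero] at h1
  · have h1 := congrArg (fg.pr (-1)) h
    simp only [map_add, map_zero] at h1
    rwa [fg.pr_of_mem hb, fg.pr_of_mem_ne (by norm_num) ha, fg.pr_of_mem_ne (by norm_num) hc,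
      fg.pr_of_mem_ne (by norm_num) hd, fg.pr_of_mem_ne (by norm_num) he,
      add_zero, add_zero, add_zero, zero_add] at h1
  · have h1 := congrArg (fg.pr 0) h
    simp only [map_add, map_zero] at h1
    rwa [fg.pr_of_mem hc, fg.pr_of_mem_ne (by norm_num) ha, fg.pr_of_mem_ne (by norm_num) hb,
      fg.pr_of_mem_ne (by norm_num) hd, fg.pr_of_mem_ne (by norm_num) he,
      add_zero, add_zero, add_zero, zero_add] at h1
  · have h1 := congrArg (fg.pr 1) h
    simp only [map_add, map_zero] at h1
    rwa [fg.pr_of_mem hd, fg.pr_of_mem_ne (by norm_num) ha, fg.pr_of_mem_ne (by norm_num) hb,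
      fg.pr_of_mem_ne (by norm_num) hc, fg.pr_of_mem_ne (by norm_num) he,
      add_zero, add_zero, add_zero, zero_add] at h1
  · have h1 := congrArg (fg.pr 2) h
    simp only [map_add, map_zero] at h1
    rwa [fg.pr_of_mem he, fg.pr_of_mem_ne (by norm_num) ha, fg.pr_of_mem_ne (by norm_num) hb,
      fg.pr_of_mem_ne (by norm_num) hc, fg.pr_of_mem_ne (by norm_num) hd,
      add_zero, add_zero, add_zero, zero_add] at h1

/-- Product of 5-gradings. -/
def FiveGrading.prod (fg : FiveGrading K L) (fg' : FiveGrading K L') :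
    FiveGrading K (L × L') where
  g i := (fg.g i).prod (fg'.g i)
  vanish i hi := by rw [fg.vanish i hi, fg'.vanish i hi, Submodule.prod_bot]
  lie_mem i j x y hx hy :=
    ⟨fg.lie_mem i j _ _ hx.1 hy.1, fg'.lie_mem i j _ _ hx.2 hy.2⟩
  internal := by
    apply isInternal_five
    · intro i hi
      rw [fg.vanish i hi, fg'.vanish i hi, Submodule.prod_bot]
    · intro x
      refine ⟨(fg.pr (-2) x.1, fg'.pr (-2) x.2), ⟨fg.pr_mem _ _, fg'.pr_mem _ _⟩,
        (fg.pr (-1) x.1, fg'.pr (-1) x.2), ⟨fg.pr_mem _ _, fg'.pr_mem _ _⟩,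
        (fg.pr 0 x.1, fg'.pr 0 x.2), ⟨fg.pr_mem _ _, fg'.pr_mem _ _⟩,
        (fg.pr 1 x.1, fg'.pr 1 x.2), ⟨fg.pr_mem _ _, fg'.pr_mem _ _⟩,
        (fg.pr 2 x.1, fg'.pr 2 x.2), ⟨fg.pr_mem _ _, fg'.pr_mem _ _⟩, ?_⟩
      exact Prod.ext (fg.sum_pr x.1) (fg'.sum_pr x.2)
    · intro a ha b hb c hc d hd e he h
      obtain ⟨h1, h2, h3, h4, h5⟩ := fg.sum_zero _ ha.1 _ hb.1 _ hc.1 _ hd.1 _ he.1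
        (congrArg Prod.fst h)
      obtain ⟨k1, k2, k3, k4, k5⟩ := fg'.sum_zero _ ha.2 _ hb.2 _ hc.2 _ hd.2 _ he.2
        (congrArg Prod.snd h)
      exact ⟨Prod.ext h1 k1, Prod.ext h2 k2, Prod.ext h3 k3, Prod.ext h4 k4, Prod.ext h5 k5⟩

theorem FiveGrading.prod_pr (fg : FiveGrading K L) (fg' : FiveGrading K L') (i : ℤ)
    (z : L × L') : (fg.prod fg').pr i z = (fg.pr i z.1, fg'.pr i z.2) := by
  induction z using (fg.prod fg').hom_induction with
  | h j z hz =>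
    by_cases hij : j = i
    · subst hij
      rw [(fg.prod fg').pr_of_mem hz, fg.pr_of_mem hz.1, fg'.pr_of_mem hz.2]
    · rw [(fg.prod fg').pr_of_mem_ne hij hz, fg.pr_of_mem_ne hij hz.1, fg'.pr_of_mem_ne hij hz.2]
      rfl
  | h0 => simp only [map_zero, Prod.fst_zero, Prod.snd_zero]; rfl
  | hadd x y hx hy => simp [hx, hy]

/-- The relation defining the isomorphism. -/
def EnvRel (E : Envelops KP fg) (E' : Envelops KP fg') (a : L) (b : L') : Prop :=
  (∃ q, E.em q = fg.pr (-1) a ∧ E'.em q = fg'.pr (-1) b) ∧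
  (∃ q, E.ep q = fg.pr 1 a ∧ E'.ep q = fg'.pr 1 b) ∧
  (∀ x, ∃ q, E.em q = ⁅fg.pr 0 a, E.em x⁆ ∧ E'.em q = ⁅fg'.pr 0 b, E'.em x⁆) ∧
  (∀ x, ∃ q, E.ep q = ⁅fg.pr 0 a, E.ep x⁆ ∧ E'.ep q = ⁅fg'.pr 0 b, E'.ep x⁆) ∧
  (∀ x, ∃ q, E.ep q = ⁅fg.pr 2 a, E.em x⁆ ∧ E'.ep q = ⁅fg'.pr 2 b, E'.em x⁆) ∧
  (∀ x, ∃ q, E.em q = ⁅fg.pr (-2) a, E.ep x⁆ ∧ E'.em q = ⁅fg'.pr (-2) b, E'.ep x⁆)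

theorem EnvRel.symm {E : Envelops KP fg} {E' : Envelops KP fg'} {a : L} {b : L'}
    (h : EnvRel E E' a b) : EnvRel E' E b a := by
  obtain ⟨⟨q, h1, h1'⟩, ⟨r, h2, h2'⟩, h3, h4, h5, h6⟩ := h
  refine ⟨⟨q, h1', h1⟩, ⟨r, h2', h2⟩, ?_, ?_, ?_, ?_⟩
  · intro x
    obtain ⟨q, h, h'⟩ := h3 x
    exact ⟨q, h', h⟩
  · intro x
    obtain ⟨q, h, h'⟩ := h4 x
    exact ⟨q, h', h⟩
  · intro x
    obtain ⟨q, h, h'⟩ := h5 x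
    exact ⟨q, h', h⟩
  · intro x
    obtain ⟨q, h, h'⟩ := h6 x
    exact ⟨q, h', h⟩

theorem Envelops.em_tr (E : Envelops KP fg) (E' : Envelops KP fg') {q : Pm} {a : L} {b : L'}
    (h : E.em q = a) (h' : E'.em q = b) (h0 : a = 0) : b = 0 := by
  have : q = 0 := E.inj_m (by rw [h, h0, map_zero])
  rw [← h', this, map_zero]

theorem Envelops.ep_tr (E : Envelops KP fg) (E' : Envelops KP fg') {q : Pp} {a : L} {b : L'}
    (h : E.ep q = a) (h' : E'.ep q = b) (h0 : a = 0) : b = 0 := by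
  have : q = 0 := E.inj_p (by rw [h, h0, map_zero])
  rw [← h', this, map_zero]

theorem EnvRel.pr_zero {E : Envelops KP fg} {E' : Envelops KP fg'} {a : L} {b : L'}
    (h : EnvRel E E' a b) (ht : Tight K fg') (j : ℤ) (hj : fg.pr j a = 0) : fg'.pr j b = 0 := by
  by_cases hc : 2 < |j|
  · exact fg'.pr_vanish hc b
  obtain ⟨⟨q, h1, h1'⟩, ⟨r, h2, h2'⟩, h3, h4, h5, h6⟩ := h
  rw [not_lt, abs_le] at hc
  have : j = -2 ∨ j = -1 ∨ j = 0 ∨ j = 1 ∨ j = 2 := by omega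
  rcases this with rfl | rfl | rfl | rfl | rfl
  · apply fg'.faithful ht (i := -2) (by simp) (fg'.pr_mem _ _)
    · intro c hc
      exact fg'.lie_zero' (by norm_num) (fg'.pr_mem _ _) hc
    · intro c hc
      obtain ⟨x, rfl⟩ := E'.exists_p hc
      obtain ⟨q, h, h'⟩ := h6 x
      exact E.em_tr E' h h' (by rw [hj, zero_lie])
  · exact E.em_tr E' h1 h1' hj
  · apply fg'.faithful ht (i := 0) (by simp) (fg'.pr_mem _ _)
    · intro c hc
      obtain ⟨x, rfl⟩ := E'.exists_m hc
      obtain ⟨q, h, h'⟩ := h3 x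
      exact E.em_tr E' h h' (by rw [hj, zero_lie])
    · intro c hc
      obtain ⟨x, rfl⟩ := E'.exists_p hc
      obtain ⟨q, h, h'⟩ := h4 x
      exact E.ep_tr E' h h' (by rw [hj, zero_lie])
  · exact E.ep_tr E' h2 h2' hj
  · apply fg'.faithful ht (i := 2) (by simp) (fg'.pr_mem _ _)
    · intro c hc
      obtain ⟨x, rfl⟩ := E'.exists_m hc
      obtain ⟨q, h, h'⟩ := h5 x
      exact E.ep_tr E' h h' (by rw [hj, zero_lie])
    · intro c hc
      exact fg'.lie_zero' (by norm_num) (fg'.pr_mem _ _) hc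

theorem FiveGrading.eq_zero_of_pr (fg : FiveGrading K L) {a : L} (h : ∀ j, fg.pr j a = 0) :
    a = 0 := by
  rw [fg.sum_pr a]
  simp [h]

/-- Relation as a submodule -/
noncomputable def RelS (E : Envelops KP fg) (E' : Envelops KP fg') : Submodule K (L × L') :=
  (fg.prod fg').nrm (LinearMap.range (E.em.prod E'.em)) (LinearMap.range (E.ep.prod E'.ep))
    (LinearMap.range (E.em.prod E'.em)) (LinearMap.range (E.ep.prod E'.ep))

theorem RelS.rel {E : Envelops KP fg} {E' : Envelops KP fg'} {z : L × L'}
    (h : z ∈ RelS E E') : EnvRel E E' z.1 z.2 := by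
  obtain ⟨h1, h2, h3, h4, h5, h6⟩ := h
  simp only [FiveGrading.prod_pr] at h1 h2 h3 h4 h5 h6
  refine ⟨?_, ?_, ?_, ?_, ?_, ?_⟩
  · obtain ⟨q, hq⟩ := h1
    exact ⟨q, congrArg Prod.fst hq, congrArg Prod.snd hq⟩
  · obtain ⟨q, hq⟩ := h2
    exact ⟨q, congrArg Prod.fst hq, congrArg Prod.snd hq⟩
  · intro x
    obtain ⟨q, hq⟩ := h3 _ ⟨x, rfl⟩
    exact ⟨q, congrArg Prod.fst hq, congrArg Prod.snd hq⟩
  · intro x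
    obtain ⟨q, hq⟩ := h4 _ ⟨x, rfl⟩
    exact ⟨q, congrArg Prod.fst hq, congrArg Prod.snd hq⟩
  · intro x
    obtain ⟨q, hq⟩ := h5 _ ⟨x, rfl⟩
    exact ⟨q, congrArg Prod.fst hq, congrArg Prod.snd hq⟩
  · intro x
    obtain ⟨q, hq⟩ := h6 _ ⟨x, rfl⟩
    exact ⟨q, congrArg Prod.fst hq, congrArg Prod.snd hq⟩

theorem Envelops.tripleM (E : Envelops KP fg) (E' : Envelops KP fg') :
    ∀ a ∈ LinearMap.range (E.em.prod E'.em), ∀ b ∈ LinearMap.range (E.ep.prod E'.ep),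
    ∀ c ∈ LinearMap.range (E.em.prod E'.em), ⁅⁅a, b⁆, c⁆ ∈ LinearMap.range (E.em.prod E'.em) := by
  rintro _ ⟨a, rfl⟩ _ ⟨b, rfl⟩ _ ⟨c, rfl⟩
  exact ⟨KP.tm a b c, Prod.ext (E.compat_m a c b) (E'.compat_m a c b)⟩

theorem Envelops.tripleP (E : Envelops KP fg) (E' : Envelops KP fg') :
    ∀ a ∈ LinearMap.range (E.ep.prod E'.ep), ∀ b ∈ LinearMap.range (E.em.prod E'.em),
    ∀ c ∈ LinearMap.range (E.ep.prod E'.ep), ⁅⁅a, b⁆, c⁆ ∈ LinearMap.range (E.ep.prod E'.ep) := by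
  rintro _ ⟨a, rfl⟩ _ ⟨b, rfl⟩ _ ⟨c, rfl⟩
  exact ⟨KP.tp a b c, Prod.ext (E.compat_p a c b) (E'.compat_p a c b)⟩

theorem RelS.triple (E : Envelops KP fg) (E' : Envelops KP fg') :
    FiveGrading.TripleCond (LinearMap.range (E.em.prod E'.em)) (LinearMap.range (E.ep.prod E'.ep))
    (LinearMap.range (E.em.prod E'.em)) (LinearMap.range (E.ep.prod E'.ep)) where
  m1 := E.tripleM E'
  m2 := E.tripleM E'
  m3 := E.tripleM E'
  p1 := E.tripleP E'
  p2 := E.tripleP E'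
  p3 := E.tripleP E'

theorem RelS.lem (E : Envelops KP fg) (E' : Envelops KP fg') :
    LinearMap.range (E.em.prod E'.em) ≤ (fg.prod fg').g (-1) := by
  rintro _ ⟨x, rfl⟩
  exact ⟨E.em_mem x, E'.em_mem x⟩

theorem RelS.lep (E : Envelops KP fg) (E' : Envelops KP fg') :
    LinearMap.range (E.ep.prod E'.ep) ≤ (fg.prod fg').g 1 := by
  rintro _ ⟨x, rfl⟩
  exact ⟨E.ep_mem x, E'.ep_mem x⟩

theorem RelS.lie_m {E : Envelops KP fg} {E' : Envelops KP fg'} (x : Pm) {z : L × L'}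
    (hz : z ∈ RelS E E') : (⁅E.em x, z.1⁆, ⁅E'.em x, z.2⁆) ∈ RelS E E' :=
  FiveGrading.nrm_lie_m (RelS.lem E E') (RelS.triple E E') ⟨x, rfl⟩ hz

theorem RelS.lie_p {E : Envelops KP fg} {E' : Envelops KP fg'} (x : Pp) {z : L × L'}
    (hz : z ∈ RelS E E') : (⁅E.ep x, z.1⁆, ⁅E'.ep x, z.2⁆) ∈ RelS E E' :=
  FiveGrading.nrm_lie_p (RelS.lep E E') (RelS.triple E E') ⟨x, rfl⟩ hz

theorem RelS.mem_m (E : Envelops KP fg) (E' : Envelops KP fg') (x : Pm) :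
    (E.em x, E'.em x) ∈ RelS E E' :=
  FiveGrading.mem_nrm_of_m ⟨E.em_mem x, E'.em_mem x⟩ ⟨x, rfl⟩

theorem RelS.mem_p (E : Envelops KP fg) (E' : Envelops KP fg') (x : Pp) :
    (E.ep x, E'.ep x) ∈ RelS E E' :=
  FiveGrading.mem_nrm_of_p ⟨E.ep_mem x, E'.ep_mem x⟩ ⟨x, rfl⟩

theorem RelS.surj_fst (E : Envelops KP fg) (E' : Envelops KP fg') (ht : Tight K fg) (a : L) :
    ∃ b, (a, b) ∈ RelS E E' := by
  have : a ∈ (RelS E E').map (LinearMap.fst K L L') := by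
    apply fg.top_of_gen ht.1
    · rintro c hc _ ⟨z, hz, rfl⟩
      obtain ⟨x, rfl⟩ := E.exists_m hc
      exact ⟨_, RelS.lie_m x hz, rfl⟩
    · rintro c hc _ ⟨z, hz, rfl⟩
      obtain ⟨x, rfl⟩ := E.exists_p hc
      exact ⟨_, RelS.lie_p x hz, rfl⟩
    · intro c hc
      obtain ⟨x, rfl⟩ := E.exists_m hc
      exact ⟨_, RelS.mem_m E E' x, rfl⟩
    · intro c hc
      obtain ⟨x, rfl⟩ := E.exists_p hc
      exact ⟨_, RelS.mem_p E E' x, rfl⟩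
  obtain ⟨z, hz, rfl⟩ := this
  exact ⟨z.2, hz⟩

theorem RelS.surj_snd (E : Envelops KP fg) (E' : Envelops KP fg') (ht : Tight K fg') (a : L') :
    ∃ b, (b, a) ∈ RelS E E' := by
  have : a ∈ (RelS E E').map (LinearMap.snd K L L') := by
    apply fg'.top_of_gen ht.1
    · rintro c hc _ ⟨z, hz, rfl⟩
      obtain ⟨x, rfl⟩ := E'.exists_m hc
      exact ⟨_, RelS.lie_m x hz, rfl⟩
    · rintro c hc _ ⟨z, hz, rfl⟩
      obtain ⟨x, rfl⟩ := E'.exists_p hc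
      exact ⟨_, RelS.lie_p x hz, rfl⟩
    · intro c hc
      obtain ⟨x, rfl⟩ := E'.exists_m hc
      exact ⟨_, RelS.mem_m E E' x, rfl⟩
    · intro c hc
      obtain ⟨x, rfl⟩ := E'.exists_p hc
      exact ⟨_, RelS.mem_p E E' x, rfl⟩
  obtain ⟨z, hz, rfl⟩ := this
  exact ⟨z.1, hz⟩

theorem tight_iso (E : Envelops KP fg) (E' : Envelops KP fg') (ht : Tight K fg)
    (ht' : Tight K fg') : ∃! φ : L ≃ₗ⁅K⁆ L',
        (∀ (i : ℤ) (x : L), x ∈ fg.g i → φ x ∈ fg'.g i) ∧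
        (∀ x : Pm, φ (E.em x) = E'.em x) ∧ (∀ y : Pp, φ (E.ep y) = E'.ep y) := by
  have inj1 : ∀ z ∈ RelS E E', z.1 = 0 → z = 0 := by
    intro z hz h
    refine Prod.ext h (fg'.eq_zero_of_pr fun j => ?_)
    exact (RelS.rel hz).pr_zero ht' j (by rw [h, map_zero])
  have inj2 : ∀ z ∈ RelS E E', z.2 = 0 → z = 0 := by
    intro z hz h
    refine Prod.ext (fg.eq_zero_of_pr fun j => ?_) h
    exact (RelS.rel hz).symm.pr_zero ht j (by rw [h, map_zero])
  obtain ⟨e, he⟩ := Submodule.exists_equiv_eq_graph (G := RelS E E')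
    (by
      constructor
      · rintro ⟨z, hz⟩ ⟨w, hw⟩ h
        have h : z.1 = w.1 := h
        have := inj1 (z - w) (sub_mem hz hw) (by simp [h])
        exact Subtype.ext (sub_eq_zero.1 this)
      · intro a
        obtain ⟨b, hb⟩ := RelS.surj_fst E E' ht a
        exact ⟨⟨_, hb⟩, rfl⟩)
    (by
      constructor
      · rintro ⟨z, hz⟩ ⟨w, hw⟩ h
        have h : z.2 = w.2 := h
        have := inj2 (z - w) (sub_mem hz hw) (by simp [h])
        exact Subtype.ext (sub_eq_zero.1 this)
      · intro a
        obtain ⟨b, hb⟩ := RelS.surj_snd E E' ht' a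
        exact ⟨⟨_, hb⟩, rfl⟩)
  have mem : ∀ a b, (a, b) ∈ RelS E E' ↔ b = e a := by
    intro a b
    rw [he, LinearMap.mem_graph_iff]
    rfl
  have hem : ∀ x, e (E.em x) = E'.em x := fun x => ((mem _ _).1 (RelS.mem_m E E' x)).symm
  have hep : ∀ x, e (E.ep x) = E'.ep x := fun x => ((mem _ _).1 (RelS.mem_p E E' x)).symm
  have hlie : ∀ x : L, ∀ y, e ⁅x, y⁆ = ⁅e x, e y⁆ := by
    intro x
    have hx : x ∈ LieSubalgebra.lieSpan K L (Tsub fg : Set L) := by rw [ht.1]; trivial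
    induction hx using LieSubalgebra.lieSpan_induction with
    | mem x h =>
      intro y
      obtain ⟨a, ha, b, hb, rfl⟩ := Submodule.mem_sup.1 h
      obtain ⟨a, rfl⟩ := E.exists_m ha
      obtain ⟨b, rfl⟩ := E.exists_p hb
      have h1 := (mem _ _).1 (RelS.lie_m a ((mem y _).2 rfl))
      have h2 := (mem _ _).1 (RelS.lie_p b ((mem y _).2 rfl))
      rw [add_lie, map_add, ← h1, ← h2, map_add, add_lie, hem, hep]
    | zero => simp
    | add x y _ _ hx hy =>
      intro z
      rw [add_lie, map_add, hx, hy, map_add, add_lie]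
    | smul c x _ hx =>
      intro z
      rw [smul_lie, map_smul, hx, map_smul, smul_lie]
    | lie x y _ _ hx hy =>
      intro z
      rw [lie_lie, map_sub, hx, hy, hy, hx, hx, lie_lie]
  refine ⟨{ e with map_lie' := fun {x y} => hlie x y }, ⟨?_, hem, hep⟩, ?_⟩
  · intro i x hx
    show e x ∈ fg'.g i
    have hr := RelS.rel ((mem x _).2 rfl)
    have : e x = fg'.pr i (e x) := by
      rw [← sub_eq_zero]
      apply fg'.eq_zero_of_pr
      intro j
      rw [map_sub]
      by_cases hij : i = j
      · subst hij
        rw [fg'.pr_of_mem (fg'.pr_mem _ _), sub_self]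
      · rw [fg'.pr_of_mem_ne hij (fg'.pr_mem _ _), sub_zero]
        exact hr.pr_zero ht' j (fg.pr_of_mem_ne hij hx)
    rw [this]
    exact fg'.pr_mem _ _
  · rintro ψ ⟨_, hm, hp⟩
    apply LieEquiv.ext
    intro x
    show ψ x = e x
    have hx : x ∈ LieSubalgebra.lieSpan K L (Tsub fg : Set L) := by rw [ht.1]; trivial
    induction hx using LieSubalgebra.lieSpan_induction with
    | mem x h =>
      obtain ⟨a, ha, b, hb, rfl⟩ := Submodule.mem_sup.1 h
      obtain ⟨a, rfl⟩ := E.exists_m ha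
      obtain ⟨b, rfl⟩ := E.exists_p hb
      rw [map_add, map_add, hm, hp, hem, hep]
    | zero => simp
    | add x y _ _ hx hy => rw [map_add, hx, hy, map_add]
    | smul c x _ hx => rw [map_smul, hx, map_smul]
    | lie x y _ _ hx hy => rw [LieEquiv.map_lie, hx, hy, hlie]

end Iso

namespace KantorPair

section Construct

set_option linter.unusedSimpArgs false

variable {K : Type*} [CommRing K] {Pm Pp : Type*}
  [AddCommGroup Pm] [AddCommGroup Pp] [Module K Pm] [Module K Pp] (KP : KantorPair K Pm Pp)

theorem tm_zero₁ (y z) : KP.tm 0 y z = 0 := by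
  have := KP.tm_smul₁ 0 0 y z
  simpa using this
theorem tm_zero₂ (y z) : KP.tm y 0 z = 0 := by
  have := KP.tm_smul₂ 0 y 0 z
  simpa using this
theorem tm_zero₃ (y z) : KP.tm y z 0 = 0 := by
  have := KP.tm_smul₃ 0 y z 0
  simpa using this
theorem tp_zero₁ (y z) : KP.tp 0 y z = 0 := by
  have := KP.tp_smul₁ 0 0 y z
  simpa using this
theorem tp_zero₂ (y z) : KP.tp y 0 z = 0 := by
  have := KP.tp_smul₂ 0 y 0 z
  simpa using this
theorem tp_zero₃ (y z) : KP.tp y z 0 = 0 := by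
  have := KP.tp_smul₃ 0 y z 0
  simpa using this
theorem tm_neg₁ (x y z) : KP.tm (-x) y z = -KP.tm x y z := by
  have := KP.tm_smul₁ (-1) x y z
  simpa using this
theorem tm_neg₂ (x y z) : KP.tm x (-y) z = -KP.tm x y z := by
  have := KP.tm_smul₂ (-1) x y z
  simpa using this
theorem tm_neg₃ (x y z) : KP.tm x y (-z) = -KP.tm x y z := by
  have := KP.tm_smul₃ (-1) x y z
  simpa using this
theorem tp_neg₁ (x y z) : KP.tp (-x) y z = -KP.tp x y z := by
  have := KP.tp_smul₁ (-1) x y z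
  simpa using this
theorem tp_neg₂ (x y z) : KP.tp x (-y) z = -KP.tp x y z := by
  have := KP.tp_smul₂ (-1) x y z
  simpa using this
theorem tp_neg₃ (x y z) : KP.tp x y (-z) = -KP.tp x y z := by
  have := KP.tp_smul₃ (-1) x y z
  simpa using this
theorem tm_sub₁ (x x' y z) : KP.tm (x - x') y z = KP.tm x y z - KP.tm x' y z := by
  rw [sub_eq_add_neg, tm_add₁, tm_neg₁, sub_eq_add_neg]
theorem tm_sub₂ (x y y' z) : KP.tm x (y - y') z = KP.tm x y z - KP.tm x y' z := by
  rw [sub_eq_add_neg, tm_add₂, tm_neg₂, sub_eq_add_neg]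
theorem tm_sub₃ (x y z z') : KP.tm x y (z - z') = KP.tm x y z - KP.tm x y z' := by
  rw [sub_eq_add_neg, tm_add₃, tm_neg₃, sub_eq_add_neg]
theorem tp_sub₁ (x x' y z) : KP.tp (x - x') y z = KP.tp x y z - KP.tp x' y z := by
  rw [sub_eq_add_neg, tp_add₁, tp_neg₁, sub_eq_add_neg]
theorem tp_sub₂ (x y y' z) : KP.tp x (y - y') z = KP.tp x y z - KP.tp x y' z := by
  rw [sub_eq_add_neg, tp_add₂, tp_neg₂, sub_eq_add_neg]
theorem tp_sub₃ (x y z z') : KP.tp x y (z - z') = KP.tp x y z - KP.tp x y z' := by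
  rw [sub_eq_add_neg, tp_add₃, tp_neg₃, sub_eq_add_neg]

/-- The Kantor pair with the two sides exchanged. -/
def op : KantorPair K Pp Pm where
  tm := KP.tp
  tp := KP.tm
  tm_add₁ := KP.tp_add₁
  tm_smul₁ := KP.tp_smul₁
  tm_add₂ := KP.tp_add₂
  tm_smul₂ := KP.tp_smul₂
  tm_add₃ := KP.tp_add₃
  tm_smul₃ := KP.tp_smul₃
  tp_add₁ := KP.tm_add₁
  tp_smul₁ := KP.tm_smul₁
  tp_add₂ := KP.tm_add₂
  tp_smul₂ := KP.tm_smul₂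
  tp_add₃ := KP.tm_add₃
  tp_smul₃ := KP.tm_smul₃
  k1m := KP.k1p
  k1p := KP.k1m
  k2m := KP.k2p
  k2p := KP.k2m

/-- The skew operator `D(x, y)` on `P⁻ ⊕ P⁺`. -/
def D (x y : Pm × Pp) : Module.End K (Pm × Pp) where
  toFun z := (KP.tm x.1 y.2 z.1 - KP.tm y.1 x.2 z.1 + (KP.tm x.1 z.2 y.1 - KP.tm y.1 z.2 x.1),
    KP.tp x.2 y.1 z.2 - KP.tp y.2 x.1 z.2 + (KP.tp x.2 z.1 y.2 - KP.tp y.2 z.1 x.2))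
  map_add' z z' := by
    ext <;> simp only [Prod.fst_add, Prod.snd_add, tm_add₂, tm_add₃, tp_add₂, tp_add₃] <;> abel
  map_smul' a z := by
    ext <;> simp only [Prod.smul_fst, Prod.smul_snd, tm_smul₂, tm_smul₃, tp_smul₂, tp_smul₃,
      RingHom.id_apply, smul_sub, smul_add]

theorem D_fst (x y z : Pm × Pp) : (KP.D x y z).1 =
    KP.tm x.1 y.2 z.1 - KP.tm y.1 x.2 z.1 + (KP.tm x.1 z.2 y.1 - KP.tm y.1 z.2 x.1) := rfl

theorem D_snd (x y z : Pm × Pp) : (KP.D x y z).2 =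
    KP.tp x.2 y.1 z.2 - KP.tp y.2 x.1 z.2 + (KP.tp x.2 z.1 y.2 - KP.tp y.2 z.1 x.2) := rfl

theorem D_add_left (x x' y : Pm × Pp) : KP.D (x + x') y = KP.D x y + KP.D x' y := by
  refine LinearMap.ext fun z => ?_
  ext <;> simp only [LinearMap.add_apply, D_fst, D_snd, Prod.fst_add, Prod.snd_add, tm_add₁,
    tm_add₂, tm_add₃, tp_add₁, tp_add₂, tp_add₃] <;> abel

theorem D_swap (x y : Pm × Pp) : KP.D y x = -KP.D x y := by
  refine LinearMap.ext fun z => ?_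
  ext <;> simp only [LinearMap.neg_apply, D_fst, D_snd, Prod.fst_neg, Prod.snd_neg] <;> abel

theorem D_self (x : Pm × Pp) : KP.D x x = 0 := by
  refine LinearMap.ext fun z => ?_
  ext <;> simp only [LinearMap.zero_apply, D_fst, D_snd, Prod.fst_zero, Prod.snd_zero] <;> abel

theorem D_smul_left (a : K) (x y : Pm × Pp) : KP.D (a • x) y = a • KP.D x y := by
  refine LinearMap.ext fun z => ?_
  ext <;> simp only [LinearMap.smul_apply, D_fst, D_snd, Prod.smul_fst, Prod.smul_snd, tm_smul₁,
    tm_smul₂, tm_smul₃, tp_smul₁, tp_smul₂, tp_smul₃, smul_add, smul_sub]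

theorem D_add_right (x y y' : Pm × Pp) : KP.D x (y + y') = KP.D x y + KP.D x y' := by
  rw [D_swap, D_add_left, D_swap KP x y, D_swap KP x y']; abel

theorem D_smul_right (a : K) (x y : Pm × Pp) : KP.D x (a • y) = a • KP.D x y := by
  rw [D_swap, D_smul_left, D_swap KP x y]; simp

theorem D_zero_left (y : Pm × Pp) : KP.D 0 y = 0 := by
  have := KP.D_add_left 0 0 y
  rwa [add_zero, left_eq_add] at this

theorem D_zero_right (y : Pm × Pp) : KP.D y 0 = 0 := by
  rw [D_swap, D_zero_left, neg_zero]

theorem D_neg_left (x y : Pm × Pp) : KP.D (-x) y = -KP.D x y :=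
  eq_neg_of_add_eq_zero_left (by rw [← D_add_left, neg_add_cancel, D_zero_left])

theorem D_neg_right (x y : Pm × Pp) : KP.D x (-y) = -KP.D x y :=
  eq_neg_of_add_eq_zero_left (by rw [← D_add_right, neg_add_cancel, D_zero_right])

theorem D_cyc (x y z : Pm × Pp) : KP.D x y z + KP.D y z x + KP.D z x y = 0 := by
  ext <;> simp only [D_fst, D_snd, Prod.fst_add, Prod.snd_add, Prod.fst_zero, Prod.snd_zero] <;>
    abel

/-- Case of the derivation identity: both operators of `K`-type, opposite signs. -/
theorem kk_m (a b u : Pm) (c d : Pp) :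
    KP.tm a (KP.tp c u d) b - KP.tm b (KP.tp c u d) a
      - (KP.tm a (KP.tp d u c) b - KP.tm b (KP.tp d u c) a)
    = KP.tm (KP.tm a c b) d u - KP.tm (KP.tm b c a) d u
      - (KP.tm (KP.tm a d b) c u - KP.tm (KP.tm b d a) c u) := by
  have h1 := KP.k2m a b u c d
  have h2 := KP.k2m a b u d c
  simp only [tm_sub₁, tm_sub₃] at h1 h2
  grind

theorem skew_m (x y z : Pm) (a b : Pp) :
    KP.tm x (KP.tp a z b) y - KP.tm y (KP.tp a z b) x
      - (KP.tm x (KP.tp b z a) y - KP.tm y (KP.tp b z a) x)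
    = KP.tm y (KP.tp a x b) z - KP.tm y (KP.tp b x a) z
      - (KP.tm x (KP.tp a y b) z - KP.tm x (KP.tp b y a) z) := by
  have h0 := KP.kk_m x y z a b
  have h1 := KP.k1m x y z a b
  have h2 := KP.k1m y x z b a
  have h3 := KP.k1m y x z a b
  have h4 := KP.k1m x y z b a
  grind

/-- The derivation identity, first component, at given arguments. -/
def DerAt (a b x y z : Pm × Pp) : Prop :=
  KP.D a b (KP.D x y z) = KP.D (KP.D a b x) y z + KP.D x (KP.D a b y) z + KP.D x y (KP.D a b z)

variable {KP} in
theorem DerAt.swap₁ {a b x y z} (h : KP.DerAt a b x y z) : KP.DerAt b a x y z := by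
  unfold DerAt at *
  rw [D_swap KP a b]
  simp only [LinearMap.neg_apply, map_neg]
  rw [h, D_neg_left, D_neg_right, LinearMap.neg_apply, LinearMap.neg_apply]
  abel

variable {KP} in
theorem DerAt.swap₂ {a b x y z} (h : KP.DerAt a b x y z) : KP.DerAt a b y x z := by
  unfold DerAt at *
  rw [D_swap KP x y, D_swap KP x (KP.D a b y), D_swap KP (KP.D a b x) y]
  simp only [LinearMap.neg_apply, map_neg]
  rw [h]
  abel

theorem kk_p (a b u : Pp) (c d : Pm) :
    KP.tp a (KP.tm c u d) b - KP.tp b (KP.tm c u d) a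
      - (KP.tp a (KP.tm d u c) b - KP.tp b (KP.tm d u c) a)
    = KP.tp (KP.tp a c b) d u - KP.tp (KP.tp b c a) d u
      - (KP.tp (KP.tp a d b) c u - KP.tp (KP.tp b d a) c u) := KP.op.kk_m a b u c d

theorem skew_p (x y z : Pp) (a b : Pm) :
    KP.tp x (KP.tm a z b) y - KP.tp y (KP.tm a z b) x
      - (KP.tp x (KP.tm b z a) y - KP.tp y (KP.tm b z a) x)
    = KP.tp y (KP.tm a x b) z - KP.tp y (KP.tm b x a) z
      - (KP.tp x (KP.tm a y b) z - KP.tp x (KP.tm b y a) z) := KP.op.skew_m x y z a b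

theorem der_mmmmm (a : Pm) (b : Pm) (x : Pm) (y : Pm) (z : Pm) :
    KP.DerAt (a, 0) (b, 0) (x, 0) (y, 0) (z, 0) := by
  unfold DerAt
  ext <;> simp only [D_fst, D_snd, Prod.fst_add, Prod.snd_add, tm_zero₁, tm_zero₂, tm_zero₃,
    tp_zero₁, tp_zero₂, tp_zero₃, tm_sub₁, tm_sub₂, tm_sub₃, tp_sub₁, tp_sub₂, tp_sub₃,
    tm_neg₁, tm_neg₂, tm_neg₃, tp_neg₁, tp_neg₂, tp_neg₃,
    sub_zero, zero_sub, add_zero, zero_add, neg_zero, sub_self]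

theorem der_mmmmp (a : Pm) (b : Pm) (x : Pm) (y : Pm) (z : Pp) :
    KP.DerAt (a, 0) (b, 0) (x, 0) (y, 0) (0, z) := by
  unfold DerAt
  ext <;> simp only [D_fst, D_snd, Prod.fst_add, Prod.snd_add, tm_zero₁, tm_zero₂, tm_zero₃,
    tp_zero₁, tp_zero₂, tp_zero₃, tm_sub₁, tm_sub₂, tm_sub₃, tp_sub₁, tp_sub₂, tp_sub₃,
    tm_neg₁, tm_neg₂, tm_neg₃, tp_neg₁, tp_neg₂, tp_neg₃,
    sub_zero, zero_sub, add_zero, zero_add, neg_zero, sub_self]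

theorem der_mmmpm (a : Pm) (b : Pm) (x : Pm) (y : Pp) (z : Pm) :
    KP.DerAt (a, 0) (b, 0) (x, 0) (0, y) (z, 0) := by
  unfold DerAt
  ext <;> simp only [D_fst, D_snd, Prod.fst_add, Prod.snd_add, tm_zero₁, tm_zero₂, tm_zero₃,
    tp_zero₁, tp_zero₂, tp_zero₃, tm_sub₁, tm_sub₂, tm_sub₃, tp_sub₁, tp_sub₂, tp_sub₃,
    tm_neg₁, tm_neg₂, tm_neg₃, tp_neg₁, tp_neg₂, tp_neg₃,
    sub_zero, zero_sub, add_zero, zero_add, neg_zero, sub_self]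

theorem der_mmmpp (a : Pm) (b : Pm) (x : Pm) (y : Pp) (z : Pp) :
    KP.DerAt (a, 0) (b, 0) (x, 0) (0, y) (0, z) := by
  have h0 := KP.k2m a b x y z
  simp only [tm_sub₁, tm_sub₃, tp_sub₁, tp_sub₃] at h0
  unfold DerAt
  ext <;> simp only [D_fst, D_snd, Prod.fst_add, Prod.snd_add, tm_zero₁, tm_zero₂, tm_zero₃,
    tp_zero₁, tp_zero₂, tp_zero₃, tm_sub₁, tm_sub₂, tm_sub₃, tp_sub₁, tp_sub₂, tp_sub₃,
    tm_neg₁, tm_neg₂, tm_neg₃, tp_neg₁, tp_neg₂, tp_neg₃,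
    sub_zero, zero_sub, add_zero, zero_add, neg_zero, sub_self]
  grind

theorem der_mmppm (a : Pm) (b : Pm) (x : Pp) (y : Pp) (z : Pm) :
    KP.DerAt (a, 0) (b, 0) (0, x) (0, y) (z, 0) := by
  have h0 := KP.kk_m a b z x y
  unfold DerAt
  ext <;> simp only [D_fst, D_snd, Prod.fst_add, Prod.snd_add, tm_zero₁, tm_zero₂, tm_zero₃,
    tp_zero₁, tp_zero₂, tp_zero₃, tm_sub₁, tm_sub₂, tm_sub₃, tp_sub₁, tp_sub₂, tp_sub₃,
    tm_neg₁, tm_neg₂, tm_neg₃, tp_neg₁, tp_neg₂, tp_neg₃,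
    sub_zero, zero_sub, add_zero, zero_add, neg_zero, sub_self]
  grind

theorem der_mmppp (a : Pm) (b : Pm) (x : Pp) (y : Pp) (z : Pp) :
    KP.DerAt (a, 0) (b, 0) (0, x) (0, y) (0, z) := by
  have h0 := KP.skew_p x y z a b
  unfold DerAt
  ext <;> simp only [D_fst, D_snd, Prod.fst_add, Prod.snd_add, tm_zero₁, tm_zero₂, tm_zero₃,
    tp_zero₁, tp_zero₂, tp_zero₃, tm_sub₁, tm_sub₂, tm_sub₃, tp_sub₁, tp_sub₂, tp_sub₃,
    tm_neg₁, tm_neg₂, tm_neg₃, tp_neg₁, tp_neg₂, tp_neg₃,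
    sub_zero, zero_sub, add_zero, zero_add, neg_zero, sub_self]
  grind

theorem der_mpmmm (a : Pm) (b : Pp) (x : Pm) (y : Pm) (z : Pm) :
    KP.DerAt (a, 0) (0, b) (x, 0) (y, 0) (z, 0) := by
  unfold DerAt
  ext <;> simp only [D_fst, D_snd, Prod.fst_add, Prod.snd_add, tm_zero₁, tm_zero₂, tm_zero₃,
    tp_zero₁, tp_zero₂, tp_zero₃, tm_sub₁, tm_sub₂, tm_sub₃, tp_sub₁, tp_sub₂, tp_sub₃,
    tm_neg₁, tm_neg₂, tm_neg₃, tp_neg₁, tp_neg₂, tp_neg₃,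
    sub_zero, zero_sub, add_zero, zero_add, neg_zero, sub_self]

theorem der_mpmmp (a : Pm) (b : Pp) (x : Pm) (y : Pm) (z : Pp) :
    KP.DerAt (a, 0) (0, b) (x, 0) (y, 0) (0, z) := by
  have h0 := KP.k1m a x y b z
  have h1 := KP.k1m a y x b z
  unfold DerAt
  ext <;> simp only [D_fst, D_snd, Prod.fst_add, Prod.snd_add, tm_zero₁, tm_zero₂, tm_zero₃,
    tp_zero₁, tp_zero₂, tp_zero₃, tm_sub₁, tm_sub₂, tm_sub₃, tp_sub₁, tp_sub₂, tp_sub₃,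
    tm_neg₁, tm_neg₂, tm_neg₃, tp_neg₁, tp_neg₂, tp_neg₃,
    sub_zero, zero_sub, add_zero, zero_add, neg_zero, sub_self]
  grind

theorem der_mpmpm (a : Pm) (b : Pp) (x : Pm) (y : Pp) (z : Pm) :
    KP.DerAt (a, 0) (0, b) (x, 0) (0, y) (z, 0) := by
  have h0 := KP.k1m a x z b y
  unfold DerAt
  ext <;> simp only [D_fst, D_snd, Prod.fst_add, Prod.snd_add, tm_zero₁, tm_zero₂, tm_zero₃,
    tp_zero₁, tp_zero₂, tp_zero₃, tm_sub₁, tm_sub₂, tm_sub₃, tp_sub₁, tp_sub₂, tp_sub₃,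
    tm_neg₁, tm_neg₂, tm_neg₃, tp_neg₁, tp_neg₂, tp_neg₃,
    sub_zero, zero_sub, add_zero, zero_add, neg_zero, sub_self]
  grind

theorem der_mpmpp (a : Pm) (b : Pp) (x : Pm) (y : Pp) (z : Pp) :
    KP.DerAt (a, 0) (0, b) (x, 0) (0, y) (0, z) := by
  have h0 := KP.k1p b y z a x
  unfold DerAt
  ext <;> simp only [D_fst, D_snd, Prod.fst_add, Prod.snd_add, tm_zero₁, tm_zero₂, tm_zero₃,
    tp_zero₁, tp_zero₂, tp_zero₃, tm_sub₁, tm_sub₂, tm_sub₃, tp_sub₁, tp_sub₂, tp_sub₃,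
    tm_neg₁, tm_neg₂, tm_neg₃, tp_neg₁, tp_neg₂, tp_neg₃,
    sub_zero, zero_sub, add_zero, zero_add, neg_zero, sub_self]
  grind

theorem der_mpppm (a : Pm) (b : Pp) (x : Pp) (y : Pp) (z : Pm) :
    KP.DerAt (a, 0) (0, b) (0, x) (0, y) (z, 0) := by
  have h0 := KP.k1p b x y a z
  have h1 := KP.k1p b y x a z
  unfold DerAt
  ext <;> simp only [D_fst, D_snd, Prod.fst_add, Prod.snd_add, tm_zero₁, tm_zero₂, tm_zero₃,
    tp_zero₁, tp_zero₂, tp_zero₃, tm_sub₁, tm_sub₂, tm_sub₃, tp_sub₁, tp_sub₂, tp_sub₃,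
    tm_neg₁, tm_neg₂, tm_neg₃, tp_neg₁, tp_neg₂, tp_neg₃,
    sub_zero, zero_sub, add_zero, zero_add, neg_zero, sub_self]
  grind

theorem der_mpppp (a : Pm) (b : Pp) (x : Pp) (y : Pp) (z : Pp) :
    KP.DerAt (a, 0) (0, b) (0, x) (0, y) (0, z) := by
  unfold DerAt
  ext <;> simp only [D_fst, D_snd, Prod.fst_add, Prod.snd_add, tm_zero₁, tm_zero₂, tm_zero₃,
    tp_zero₁, tp_zero₂, tp_zero₃, tm_sub₁, tm_sub₂, tm_sub₃, tp_sub₁, tp_sub₂, tp_sub₃,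
    tm_neg₁, tm_neg₂, tm_neg₃, tp_neg₁, tp_neg₂, tp_neg₃,
    sub_zero, zero_sub, add_zero, zero_add, neg_zero, sub_self]

theorem der_ppmmm (a : Pp) (b : Pp) (x : Pm) (y : Pm) (z : Pm) :
    KP.DerAt (0, a) (0, b) (x, 0) (y, 0) (z, 0) := by
  have h0 := KP.skew_m x y z a b
  unfold DerAt
  ext <;> simp only [D_fst, D_snd, Prod.fst_add, Prod.snd_add, tm_zero₁, tm_zero₂, tm_zero₃,
    tp_zero₁, tp_zero₂, tp_zero₃, tm_sub₁, tm_sub₂, tm_sub₃, tp_sub₁, tp_sub₂, tp_sub₃,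
    tm_neg₁, tm_neg₂, tm_neg₃, tp_neg₁, tp_neg₂, tp_neg₃,
    sub_zero, zero_sub, add_zero, zero_add, neg_zero, sub_self]
  grind

theorem der_ppmmp (a : Pp) (b : Pp) (x : Pm) (y : Pm) (z : Pp) :
    KP.DerAt (0, a) (0, b) (x, 0) (y, 0) (0, z) := by
  have h0 := KP.kk_p a b z x y
  unfold DerAt
  ext <;> simp only [D_fst, D_snd, Prod.fst_add, Prod.snd_add, tm_zero₁, tm_zero₂, tm_zero₃,
    tp_zero₁, tp_zero₂, tp_zero₃, tm_sub₁, tm_sub₂, tm_sub₃, tp_sub₁, tp_sub₂, tp_sub₃,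
    tm_neg₁, tm_neg₂, tm_neg₃, tp_neg₁, tp_neg₂, tp_neg₃,
    sub_zero, zero_sub, add_zero, zero_add, neg_zero, sub_self]
  grind

theorem der_ppmpm (a : Pp) (b : Pp) (x : Pm) (y : Pp) (z : Pm) :
    KP.DerAt (0, a) (0, b) (x, 0) (0, y) (z, 0) := by
  have h0 := KP.k2p a b y x z
  simp only [tm_sub₁, tm_sub₃, tp_sub₁, tp_sub₃] at h0
  unfold DerAt
  ext <;> simp only [D_fst, D_snd, Prod.fst_add, Prod.snd_add, tm_zero₁, tm_zero₂, tm_zero₃,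
    tp_zero₁, tp_zero₂, tp_zero₃, tm_sub₁, tm_sub₂, tm_sub₃, tp_sub₁, tp_sub₂, tp_sub₃,
    tm_neg₁, tm_neg₂, tm_neg₃, tp_neg₁, tp_neg₂, tp_neg₃,
    sub_zero, zero_sub, add_zero, zero_add, neg_zero, sub_self]
  grind

theorem der_ppmpp (a : Pp) (b : Pp) (x : Pm) (y : Pp) (z : Pp) :
    KP.DerAt (0, a) (0, b) (x, 0) (0, y) (0, z) := by
  unfold DerAt
  ext <;> simp only [D_fst, D_snd, Prod.fst_add, Prod.snd_add, tm_zero₁, tm_zero₂, tm_zero₃,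
    tp_zero₁, tp_zero₂, tp_zero₃, tm_sub₁, tm_sub₂, tm_sub₃, tp_sub₁, tp_sub₂, tp_sub₃,
    tm_neg₁, tm_neg₂, tm_neg₃, tp_neg₁, tp_neg₂, tp_neg₃,
    sub_zero, zero_sub, add_zero, zero_add, neg_zero, sub_self]

theorem der_ppppm (a : Pp) (b : Pp) (x : Pp) (y : Pp) (z : Pm) :
    KP.DerAt (0, a) (0, b) (0, x) (0, y) (z, 0) := by
  unfold DerAt
  ext <;> simp only [D_fst, D_snd, Prod.fst_add, Prod.snd_add, tm_zero₁, tm_zero₂, tm_zero₃,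
    tp_zero₁, tp_zero₂, tp_zero₃, tm_sub₁, tm_sub₂, tm_sub₃, tp_sub₁, tp_sub₂, tp_sub₃,
    tm_neg₁, tm_neg₂, tm_neg₃, tp_neg₁, tp_neg₂, tp_neg₃,
    sub_zero, zero_sub, add_zero, zero_add, neg_zero, sub_self]

theorem der_ppppp (a : Pp) (b : Pp) (x : Pp) (y : Pp) (z : Pp) :
    KP.DerAt (0, a) (0, b) (0, x) (0, y) (0, z) := by
  unfold DerAt
  ext <;> simp only [D_fst, D_snd, Prod.fst_add, Prod.snd_add, tm_zero₁, tm_zero₂, tm_zero₃,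
    tp_zero₁, tp_zero₂, tp_zero₃, tm_sub₁, tm_sub₂, tm_sub₃, tp_sub₁, tp_sub₂, tp_sub₃,
    tm_neg₁, tm_neg₂, tm_neg₃, tp_neg₁, tp_neg₂, tp_neg₃,
    sub_zero, zero_sub, add_zero, zero_add, neg_zero, sub_self]

theorem prod_ind {p : Pm × Pp → Prop} (hadd : ∀ u v, p u → p v → p (u + v))
    (hm : ∀ u, p (u, 0)) (hp : ∀ u, p (0, u)) (u : Pm × Pp) : p u := by
  have := hadd _ _ (hm u.1) (hp u.2)
  simpa using this

variable {KP} in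
theorem derAt_add₁ {b x y z} (a a') (h : KP.DerAt a b x y z) (h' : KP.DerAt a' b x y z) :
    KP.DerAt (a + a') b x y z := by
  unfold DerAt at *
  simp only [D_add_left, D_add_right, LinearMap.add_apply, map_add, h, h']
  abel

variable {KP} in
theorem derAt_add₂ {a x y z} (b b') (h : KP.DerAt a b x y z) (h' : KP.DerAt a b' x y z) :
    KP.DerAt a (b + b') x y z := by
  unfold DerAt at *
  simp only [D_add_left, D_add_right, LinearMap.add_apply, map_add, h, h']
  abel

variable {KP} in
theorem derAt_add₃ {a b y z} (x x') (h : KP.DerAt a b x y z) (h' : KP.DerAt a b x' y z) :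
    KP.DerAt a b (x + x') y z := by
  unfold DerAt at *
  simp only [D_add_left, D_add_right, LinearMap.add_apply, map_add, h, h']
  abel

variable {KP} in
theorem derAt_add₄ {a b x z} (y y') (h : KP.DerAt a b x y z) (h' : KP.DerAt a b x y' z) :
    KP.DerAt a b x (y + y') z := by
  unfold DerAt at *
  simp only [D_add_left, D_add_right, LinearMap.add_apply, map_add, h, h']
  abel

variable {KP} in
theorem derAt_add₅ {a b x y} (z z') (h : KP.DerAt a b x y z) (h' : KP.DerAt a b x y z') :
    KP.DerAt a b x y (z + z') := by
  unfold DerAt at *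
  simp only [LinearMap.add_apply, map_add, h, h']
  abel

theorem derz_mmmm (a : Pm) (b : Pm) (x : Pm) (y : Pm) (z : Pm × Pp) :
    KP.DerAt (a, 0) (b, 0) (x, 0) (y, 0) z :=
  prod_ind (p := fun z => KP.DerAt (a, 0) (b, 0) (x, 0) (y, 0) z) derAt_add₅
    (fun z => KP.der_mmmmm a b x y z) (fun z => KP.der_mmmmp a b x y z) z

theorem derz_mmmp (a : Pm) (b : Pm) (x : Pm) (y : Pp) (z : Pm × Pp) :
    KP.DerAt (a, 0) (b, 0) (x, 0) (0, y) z :=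
  prod_ind (p := fun z => KP.DerAt (a, 0) (b, 0) (x, 0) (0, y) z) derAt_add₅
    (fun z => KP.der_mmmpm a b x y z) (fun z => KP.der_mmmpp a b x y z) z

theorem derz_mmpp (a : Pm) (b : Pm) (x : Pp) (y : Pp) (z : Pm × Pp) :
    KP.DerAt (a, 0) (b, 0) (0, x) (0, y) z :=
  prod_ind (p := fun z => KP.DerAt (a, 0) (b, 0) (0, x) (0, y) z) derAt_add₅
    (fun z => KP.der_mmppm a b x y z) (fun z => KP.der_mmppp a b x y z) z

theorem derz_mpmm (a : Pm) (b : Pp) (x : Pm) (y : Pm) (z : Pm × Pp) :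
    KP.DerAt (a, 0) (0, b) (x, 0) (y, 0) z :=
  prod_ind (p := fun z => KP.DerAt (a, 0) (0, b) (x, 0) (y, 0) z) derAt_add₅
    (fun z => KP.der_mpmmm a b x y z) (fun z => KP.der_mpmmp a b x y z) z

theorem derz_mpmp (a : Pm) (b : Pp) (x : Pm) (y : Pp) (z : Pm × Pp) :
    KP.DerAt (a, 0) (0, b) (x, 0) (0, y) z :=
  prod_ind (p := fun z => KP.DerAt (a, 0) (0, b) (x, 0) (0, y) z) derAt_add₅
    (fun z => KP.der_mpmpm a b x y z) (fun z => KP.der_mpmpp a b x y z) z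

theorem derz_mppp (a : Pm) (b : Pp) (x : Pp) (y : Pp) (z : Pm × Pp) :
    KP.DerAt (a, 0) (0, b) (0, x) (0, y) z :=
  prod_ind (p := fun z => KP.DerAt (a, 0) (0, b) (0, x) (0, y) z) derAt_add₅
    (fun z => KP.der_mpppm a b x y z) (fun z => KP.der_mpppp a b x y z) z

theorem derz_ppmm (a : Pp) (b : Pp) (x : Pm) (y : Pm) (z : Pm × Pp) :
    KP.DerAt (0, a) (0, b) (x, 0) (y, 0) z :=
  prod_ind (p := fun z => KP.DerAt (0, a) (0, b) (x, 0) (y, 0) z) derAt_add₅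
    (fun z => KP.der_ppmmm a b x y z) (fun z => KP.der_ppmmp a b x y z) z

theorem derz_ppmp (a : Pp) (b : Pp) (x : Pm) (y : Pp) (z : Pm × Pp) :
    KP.DerAt (0, a) (0, b) (x, 0) (0, y) z :=
  prod_ind (p := fun z => KP.DerAt (0, a) (0, b) (x, 0) (0, y) z) derAt_add₅
    (fun z => KP.der_ppmpm a b x y z) (fun z => KP.der_ppmpp a b x y z) z

theorem derz_pppp (a : Pp) (b : Pp) (x : Pp) (y : Pp) (z : Pm × Pp) :
    KP.DerAt (0, a) (0, b) (0, x) (0, y) z :=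
  prod_ind (p := fun z => KP.DerAt (0, a) (0, b) (0, x) (0, y) z) derAt_add₅
    (fun z => KP.der_ppppm a b x y z) (fun z => KP.der_ppppp a b x y z) z

theorem derxy_mm (a : Pm) (b : Pm) (x y z : Pm × Pp) : KP.DerAt (a, 0) (b, 0) x y z := by
  refine prod_ind (p := fun x => KP.DerAt (a, 0) (b, 0) x y z) derAt_add₃ (fun x => ?_) (fun x => ?_) x
  · exact prod_ind (p := fun y => KP.DerAt (a, 0) (b, 0) (x, 0) y z) derAt_add₄
      (fun y => KP.derz_mmmm a b x y z) (fun y => KP.derz_mmmp a b x y z) y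
  · exact prod_ind (p := fun y => KP.DerAt (a, 0) (b, 0) (0, x) y z) derAt_add₄
      (fun y => (KP.derz_mmmp a b y x z).swap₂) (fun y => KP.derz_mmpp a b x y z) y

theorem derxy_mp (a : Pm) (b : Pp) (x y z : Pm × Pp) : KP.DerAt (a, 0) (0, b) x y z := by
  refine prod_ind (p := fun x => KP.DerAt (a, 0) (0, b) x y z) derAt_add₃ (fun x => ?_) (fun x => ?_) x
  · exact prod_ind (p := fun y => KP.DerAt (a, 0) (0, b) (x, 0) y z) derAt_add₄
      (fun y => KP.derz_mpmm a b x y z) (fun y => KP.derz_mpmp a b x y z) y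
  · exact prod_ind (p := fun y => KP.DerAt (a, 0) (0, b) (0, x) y z) derAt_add₄
      (fun y => (KP.derz_mpmp a b y x z).swap₂) (fun y => KP.derz_mppp a b x y z) y

theorem derxy_pp (a : Pp) (b : Pp) (x y z : Pm × Pp) : KP.DerAt (0, a) (0, b) x y z := by
  refine prod_ind (p := fun x => KP.DerAt (0, a) (0, b) x y z) derAt_add₃ (fun x => ?_) (fun x => ?_) x
  · exact prod_ind (p := fun y => KP.DerAt (0, a) (0, b) (x, 0) y z) derAt_add₄
      (fun y => KP.derz_ppmm a b x y z) (fun y => KP.derz_ppmp a b x y z) y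
  · exact prod_ind (p := fun y => KP.DerAt (0, a) (0, b) (0, x) y z) derAt_add₄
      (fun y => (KP.derz_ppmp a b y x z).swap₂) (fun y => KP.derz_pppp a b x y z) y

theorem derAt (a b x y z : Pm × Pp) : KP.DerAt a b x y z := by
  refine prod_ind (p := fun a => KP.DerAt a b x y z) derAt_add₁ (fun a => ?_) (fun a => ?_) a
  · exact prod_ind (p := fun b => KP.DerAt (a, 0) b x y z) derAt_add₂
      (fun b => KP.derxy_mm a b x y z) (fun b => KP.derxy_mp a b x y z) b
  · exact prod_ind (p := fun b => KP.DerAt (0, a) b x y z) derAt_add₂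
      (fun b => (KP.derxy_mp b a x y z).swap₁) (fun b => KP.derxy_pp a b x y z) b

end Construct
end KantorPair

namespace KantorPair

section Construct2

universe u₁ u₂ u₃

variable {K : Type u₁} [CommRing K] {Pm : Type u₂} {Pp : Type u₃}
  [AddCommGroup Pm] [AddCommGroup Pp] [Module K Pm] [Module K Pp] (KP : KantorPair K Pm Pp)

/-- The span of all operators `D(x, y)`. -/
def innerS : Submodule K (Module.End K (Pm × Pp)) :=
  Submodule.span K {A | ∃ x y, A = KP.D x y}

theorem D_mem_innerS (x y : Pm × Pp) : KP.D x y ∈ KP.innerS :=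
  Submodule.subset_span ⟨x, y, rfl⟩

theorem comm_D {A : Module.End K (Pm × Pp)} (hA : A ∈ KP.innerS) (x y : Pm × Pp) :
    A * KP.D x y - KP.D x y * A = KP.D (A x) y + KP.D x (A y) := by
  induction hA using Submodule.span_induction with
  | mem A hA =>
    obtain ⟨a, b, rfl⟩ := hA
    refine LinearMap.ext fun z => ?_
    have := KP.derAt a b x y z
    unfold DerAt at this
    rw [LinearMap.sub_apply, Module.End.mul_apply, Module.End.mul_apply, this,
      LinearMap.add_apply]
    abel
  | zero => simp [D_zero_left, D_zero_right]
  | add A B _ _ hA hB =>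
    rw [add_mul, mul_add, add_sub_add_comm, hA, hB, LinearMap.add_apply, LinearMap.add_apply,
      D_add_left, D_add_right]
    abel
  | smul a A _ hA =>
    rw [smul_mul_assoc, mul_smul_comm, ← smul_sub, hA, LinearMap.smul_apply,
      LinearMap.smul_apply, D_smul_left, D_smul_right, smul_add]

theorem comm_mem {A B : Module.End K (Pm × Pp)} (hA : A ∈ KP.innerS) (hB : B ∈ KP.innerS) :
    A * B - B * A ∈ KP.innerS := by
  induction hB using Submodule.span_induction with
  | mem B hB =>
    obtain ⟨x, y, rfl⟩ := hB
    rw [KP.comm_D hA]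
    exact add_mem (KP.D_mem_innerS _ _) (KP.D_mem_innerS _ _)
  | zero => simp
  | add B C _ _ hB hC =>
    rw [add_mul, mul_add, add_sub_add_comm]; exact add_mem hB hC
  | smul a B _ hB =>
    rw [smul_mul_assoc, mul_smul_comm, ← smul_sub]; exact Submodule.smul_mem _ _ hB

/-- The underlying module of the Kantor Lie algebra (the factor `PUnit` adjusts the universe). -/
def KL : Type (max u₁ u₂ u₃) := (KP.innerS × (Pm × Pp)) × PUnit.{u₁ + 1}

instance : AddCommGroup KP.KL :=
  inferInstanceAs (AddCommGroup ((KP.innerS × (Pm × Pp)) × PUnit.{u₁ + 1}))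

instance : Module K KP.KL :=
  inferInstanceAs (Module K ((KP.innerS × (Pm × Pp)) × PUnit.{u₁ + 1}))

namespace KL

variable {KP}

/-- The operator part. -/
def opl : KP.KL →ₗ[K] Module.End K (Pm × Pp) :=
  (Submodule.subtype KP.innerS).comp ((LinearMap.fst K KP.innerS (Pm × Pp)).comp
    (LinearMap.fst K (KP.innerS × (Pm × Pp)) PUnit.{u₁ + 1}))

/-- The vector part. -/
def vec : KP.KL →ₗ[K] Pm × Pp :=
  (LinearMap.snd K KP.innerS (Pm × Pp)).comp
    (LinearMap.fst K (KP.innerS × (Pm × Pp)) PUnit.{u₁ + 1})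

/-- Constructor. -/
def mk (A : Module.End K (Pm × Pp)) (hA : A ∈ KP.innerS) (x : Pm × Pp) : KP.KL :=
  ((⟨A, hA⟩, x), PUnit.unit)

@[simp] theorem opl_mk (A : Module.End K (Pm × Pp)) (hA : A ∈ KP.innerS) (x : Pm × Pp) :
    opl (mk A hA x) = A := rfl

@[simp] theorem vec_mk (A : Module.End K (Pm × Pp)) (hA : A ∈ KP.innerS) (x : Pm × Pp) :
    vec (mk A hA x) = x := rfl

theorem opl_mem (z : KP.KL) : opl z ∈ KP.innerS := z.1.1.2

theorem ext' {z z' : KP.KL} (h1 : opl z = opl z') (h2 : vec z = vec z') : z = z' := by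
  obtain ⟨⟨⟨A, hA⟩, x⟩, ⟨⟩⟩ := z
  obtain ⟨⟨⟨B, hB⟩, y⟩, ⟨⟩⟩ := z'
  change A = B at h1
  change x = y at h2
  subst h1 h2
  rfl

instance : Bracket KP.KL KP.KL where
  bracket z z' := mk (opl z * opl z' - opl z' * opl z + KP.D (vec z) (vec z'))
    (add_mem (KP.comm_mem (opl_mem z) (opl_mem z')) (KP.D_mem_innerS _ _))
    (opl z (vec z') - opl z' (vec z))

@[simp] theorem opl_lie (z z' : KP.KL) :
    opl ⁅z, z'⁆ = opl z * opl z' - opl z' * opl z + KP.D (vec z) (vec z') := rfl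

@[simp] theorem vec_lie (z z' : KP.KL) :
    vec ⁅z, z'⁆ = opl z (vec z') - opl z' (vec z) := rfl

theorem D_sub_left (x x' y : Pm × Pp) : KP.D (x - x') y = KP.D x y - KP.D x' y := by
  rw [sub_eq_add_neg, D_add_left, D_neg_left, sub_eq_add_neg]

theorem D_sub_right (x x' y : Pm × Pp) : KP.D y (x - x') = KP.D y x - KP.D y x' := by
  rw [sub_eq_add_neg, D_add_right, D_neg_right, sub_eq_add_neg]

instance : LieRing KP.KL where
  add_lie x y z := by
    refine ext' ?_ ?_
    · simp only [opl_lie, map_add, add_mul, mul_add, D_add_left]; abel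
    · simp only [vec_lie, map_add, LinearMap.add_apply]; abel
  lie_add x y z := by
    refine ext' ?_ ?_
    · simp only [opl_lie, map_add, add_mul, mul_add, D_add_right]; abel
    · simp only [vec_lie, map_add, LinearMap.add_apply]; abel
  lie_self x := by
    refine ext' ?_ ?_
    · simp only [opl_lie, sub_self, D_self, map_zero, add_zero]
    · simp only [vec_lie, sub_self, map_zero]
  leibniz_lie x y z := by
    refine ext' ?_ ?_
    · have h1 := KP.comm_D (opl_mem x) (vec y) (vec z)
      have h2 := KP.comm_D (opl_mem y) (vec x) (vec z)
      have h3 := KP.comm_D (opl_mem z) (vec x) (vec y)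
      simp only [opl_lie, vec_lie, map_add, add_mul, mul_add, sub_mul, mul_sub, D_sub_left,
        D_sub_right, mul_assoc] at *
      rw [KP.D_swap (vec y) (opl z (vec x))] at *
      grind
    · have h := KP.D_cyc (vec x) (vec y) (vec z)
      rw [KP.D_swap (vec x) (vec z)] at h
      simp only [opl_lie, vec_lie, map_add, map_sub, LinearMap.add_apply, LinearMap.sub_apply,
        LinearMap.neg_apply, Module.End.mul_apply] at *
      grind

instance : LieAlgebra K KP.KL where
  lie_smul a x y := by
    refine ext' ?_ ?_
    · simp only [opl_lie, map_smul, D_smul_right, smul_add, smul_sub, mul_smul_comm,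
        smul_mul_assoc]
    · simp only [vec_lie, map_smul, smul_sub, LinearMap.smul_apply]

end KL

end Construct2
end KantorPair

namespace KantorPair

section Construct3

universe u₁ u₂ u₃

variable {K : Type u₁} [CommRing K] {Pm : Type u₂} {Pp : Type u₃}
  [AddCommGroup Pm] [AddCommGroup Pp] [Module K Pm] [Module K Pp] (KP : KantorPair K Pm Pp)

/-- The grading of `P⁻ ⊕ P⁺`. -/
def tg (K : Type*) [CommRing K] (Pm Pp : Type*) [AddCommGroup Pm] [AddCommGroup Pp] [Module K Pm]
    [Module K Pp] (i : ℤ) : Submodule K (Pm × Pp) where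
  carrier := {x | (x.1 = 0 ∨ i = -1) ∧ (x.2 = 0 ∨ i = 1)}
  add_mem' {x y} hx hy := by
    refine ⟨?_, ?_⟩
    · rcases hx.1 with h | h
      · rcases hy.1 with h' | h'
        · left; rw [Prod.fst_add, h, h', add_zero]
        · exact Or.inr h'
      · exact Or.inr h
    · rcases hx.2 with h | h
      · rcases hy.2 with h' | h'
        · left; rw [Prod.snd_add, h, h', add_zero]
        · exact Or.inr h'
      · exact Or.inr h
  zero_mem' := ⟨Or.inl rfl, Or.inl rfl⟩
  smul_mem' a x hx := by
    refine ⟨?_, ?_⟩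
    · rcases hx.1 with h | h
      · left; rw [Prod.smul_fst, h, smul_zero]
      · exact Or.inr h
    · rcases hx.2 with h | h
      · left; rw [Prod.smul_snd, h, smul_zero]
      · exact Or.inr h

theorem mem_tg {i : ℤ} {x : Pm × Pp} :
    x ∈ tg K Pm Pp i ↔ (x.1 = 0 ∨ i = -1) ∧ (x.2 = 0 ∨ i = 1) := Iff.rfl

/-- The grading of the endomorphisms of `P⁻ ⊕ P⁺`. -/
def eg (K : Type*) [CommRing K] (Pm Pp : Type*) [AddCommGroup Pm] [AddCommGroup Pp] [Module K Pm]
    [Module K Pp] (i : ℤ) : Submodule K (Module.End K (Pm × Pp)) where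
  carrier := {A | ∀ j x, x ∈ tg K Pm Pp j → A x ∈ tg K Pm Pp (i + j)}
  add_mem' {A B} hA hB := fun j x hx => add_mem (hA j x hx) (hB j x hx)
  zero_mem' := fun j x _ => zero_mem _
  smul_mem' a A hA := fun j x hx => Submodule.smul_mem _ a (hA j x hx)

theorem mem_eg {i : ℤ} {A : Module.End K (Pm × Pp)} :
    A ∈ eg K Pm Pp i ↔ ∀ j x, x ∈ tg K Pm Pp j → A x ∈ tg K Pm Pp (i + j) := Iff.rfl

theorem tm_deg {i j k n : ℤ} {x y z} (hx : x = 0 ∨ i = -1) (hy : y = 0 ∨ j = 1)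
    (hz : z = 0 ∨ k = -1) (hn : i + j + k = n) (h : ¬ n = -1) : KP.tm x y z = 0 := by
  rcases hx with rfl | hx
  · exact KP.tm_zero₁ _ _
  rcases hy with rfl | hy
  · exact KP.tm_zero₂ _ _
  rcases hz with rfl | hz
  · exact KP.tm_zero₃ _ _
  omega

theorem tp_deg {i j k n : ℤ} {x y z} (hx : x = 0 ∨ i = 1) (hy : y = 0 ∨ j = -1)
    (hz : z = 0 ∨ k = 1) (hn : i + j + k = n) (h : ¬ n = 1) : KP.tp x y z = 0 := by
  rcases hx with rfl | hx
  · exact KP.tp_zero₁ _ _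
  rcases hy with rfl | hy
  · exact KP.tp_zero₂ _ _
  rcases hz with rfl | hz
  · exact KP.tp_zero₃ _ _
  omega

theorem D_mem_eg {i j : ℤ} {x y : Pm × Pp} (hx : x ∈ tg K Pm Pp i) (hy : y ∈ tg K Pm Pp j) :
    KP.D x y ∈ eg K Pm Pp (i + j) := by
  intro k z hz
  rw [mem_tg] at *
  constructor
  · by_cases h : i + j + k = -1
    · exact Or.inr h
    · left
      rw [D_fst, KP.tm_deg hx.1 hy.2 hz.1 rfl h, KP.tm_deg hy.1 hx.2 hz.1 (n := i + j + k) (by ring) h,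
        KP.tm_deg hx.1 hz.2 hy.1 (n := i + j + k) (by ring) h,
        KP.tm_deg hy.1 hz.2 hx.1 (n := i + j + k) (by ring) h]
      simp
  · by_cases h : i + j + k = 1
    · exact Or.inr h
    · left
      rw [D_snd, KP.tp_deg hx.2 hy.1 hz.2 rfl h, KP.tp_deg hy.2 hx.1 hz.2 (n := i + j + k) (by ring) h,
        KP.tp_deg hx.2 hz.1 hy.2 (n := i + j + k) (by ring) h,
        KP.tp_deg hy.2 hz.1 hx.2 (n := i + j + k) (by ring) h]
      simp

theorem m_mem_tg (x : Pm) : ((x, 0) : Pm × Pp) ∈ tg K Pm Pp (-1) := ⟨Or.inr rfl, Or.inl rfl⟩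
theorem p_mem_tg (x : Pp) : ((0, x) : Pm × Pp) ∈ tg K Pm Pp 1 := ⟨Or.inl rfl, Or.inr rfl⟩

theorem eg_mm {i : ℤ} {A : Module.End K (Pm × Pp)} (hA : A ∈ eg K Pm Pp i) (hi : i ≠ 0) (x : Pm) :
    (A (x, 0)).1 = 0 := by
  rcases (hA _ _ (m_mem_tg x)).1 with h | h
  · exact h
  · omega

theorem eg_mp {i : ℤ} {A : Module.End K (Pm × Pp)} (hA : A ∈ eg K Pm Pp i) (hi : i ≠ 2) (x : Pm) :
    (A (x, 0)).2 = 0 := by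
  rcases (hA _ _ (m_mem_tg x)).2 with h | h
  · exact h
  · omega

theorem eg_pm {i : ℤ} {A : Module.End K (Pm × Pp)} (hA : A ∈ eg K Pm Pp i) (hi : i ≠ -2) (x : Pp) :
    (A (0, x)).1 = 0 := by
  rcases (hA _ _ (p_mem_tg x)).1 with h | h
  · exact h
  · omega

theorem eg_pp {i : ℤ} {A : Module.End K (Pm × Pp)} (hA : A ∈ eg K Pm Pp i) (hi : i ≠ 0) (x : Pp) :
    (A (0, x)).2 = 0 := by
  rcases (hA _ _ (p_mem_tg x)).2 with h | h
  · exact h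
  · omega

theorem end_zero {A : Module.End K (Pm × Pp)} (h1 : ∀ x, (A (x, 0)).1 = 0)
    (h2 : ∀ x, (A (x, 0)).2 = 0) (h3 : ∀ x, (A (0, x)).1 = 0) (h4 : ∀ x, (A (0, x)).2 = 0) :
    A = 0 := by
  refine LinearMap.ext fun x => ?_
  refine prod_ind (p := fun x => A x = 0) ?_ ?_ ?_ x
  · intro u v hu hv
    rw [map_add, hu, hv, add_zero]
  · exact fun u => Prod.ext (h1 u) (h2 u)
  · exact fun u => Prod.ext (h3 u) (h4 u)

theorem eg_zero {i : ℤ} {A : Module.End K (Pm × Pp)} (hA : A ∈ eg K Pm Pp i) (h0 : i ≠ 0)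
    (h2 : i ≠ 2) (h2' : i ≠ -2) : A = 0 :=
  end_zero (eg_mm hA h0) (eg_mp hA h2) (eg_pm hA h2') (eg_pp hA h0)

theorem inner_decomp {A : Module.End K (Pm × Pp)} (hA : A ∈ KP.innerS) :
    ∃ a ∈ KP.innerS ⊓ eg K Pm Pp (-2), ∃ b ∈ KP.innerS ⊓ eg K Pm Pp 0,
      ∃ c ∈ KP.innerS ⊓ eg K Pm Pp 2, A = a + b + c := by
  induction hA using Submodule.span_induction with
  | mem A hA =>
    obtain ⟨x, y, rfl⟩ := hA
    refine ⟨KP.D (x.1, 0) (y.1, 0), ⟨KP.D_mem_innerS _ _, KP.D_mem_eg (m_mem_tg _) (m_mem_tg _)⟩,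
      KP.D (x.1, 0) (0, y.2) + KP.D (0, x.2) (y.1, 0),
      ⟨add_mem (KP.D_mem_innerS _ _) (KP.D_mem_innerS _ _),
        add_mem (KP.D_mem_eg (m_mem_tg _) (p_mem_tg _)) (KP.D_mem_eg (p_mem_tg _) (m_mem_tg _))⟩,
      KP.D (0, x.2) (0, y.2),
      ⟨KP.D_mem_innerS _ _, KP.D_mem_eg (p_mem_tg _) (p_mem_tg _)⟩, ?_⟩
    have hx : x = (x.1, 0) + (0, x.2) := by simp
    have hy : y = (y.1, 0) + (0, y.2) := by simp
    conv_lhs => rw [hx, hy]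
    rw [D_add_left, D_add_right, D_add_right]
    abel
  | zero => exact ⟨0, zero_mem _, 0, zero_mem _, 0, zero_mem _, by simp⟩
  | add A B _ _ hA hB =>
    obtain ⟨a, ha, b, hb, c, hc, rfl⟩ := hA
    obtain ⟨a', ha', b', hb', c', hc', rfl⟩ := hB
    exact ⟨a + a', add_mem ha ha', b + b', add_mem hb hb', c + c', add_mem hc hc', by abel⟩
  | smul r A _ hA =>
    obtain ⟨a, ha, b, hb, c, hc, rfl⟩ := hA
    exact ⟨r • a, Submodule.smul_mem _ _ ha, r • b, Submodule.smul_mem _ _ hb, r • c,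
      Submodule.smul_mem _ _ hc, by rw [smul_add, smul_add]⟩

theorem tg_zero {i : ℤ} {x : Pm × Pp} (hx : x ∈ tg K Pm Pp i) (h : i ≠ -1) (h' : i ≠ 1) :
    x = 0 :=
  Prod.ext (hx.1.resolve_right h) (hx.2.resolve_right h')

namespace KL

/-- The homogeneous components of the Kantor Lie algebra. -/
def g (i : ℤ) : Submodule K KP.KL := (eg K Pm Pp i).comap opl ⊓ (tg K Pm Pp i).comap vec

variable {KP}

theorem mem_g {i : ℤ} {z : KP.KL} : z ∈ g KP i ↔ opl z ∈ eg K Pm Pp i ∧ vec z ∈ tg K Pm Pp i :=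
  Iff.rfl

theorem mk_mem_g {i : ℤ} {A : Module.End K (Pm × Pp)} (hA : A ∈ KP.innerS)
    (hA' : A ∈ eg K Pm Pp i) : mk A hA 0 ∈ g KP i :=
  mem_g.2 ⟨hA', zero_mem (tg K Pm Pp i)⟩

theorem mk_mem_g' {i : ℤ} {x : Pm × Pp} (hx : x ∈ tg K Pm Pp i) :
    mk 0 (zero_mem KP.innerS) x ∈ g KP i :=
  mem_g.2 ⟨zero_mem (eg K Pm Pp i), hx⟩

theorem comp_mem_eg {i j : ℤ} {A B : Module.End K (Pm × Pp)} (hA : A ∈ eg K Pm Pp i)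
    (hB : B ∈ eg K Pm Pp j) : A * B ∈ eg K Pm Pp (i + j) := by
  intro k x hx
  rw [add_assoc]
  exact hA _ _ (hB _ _ hx)

theorem g_lie (i j : ℤ) (x y : KP.KL) (hx : x ∈ g KP i) (hy : y ∈ g KP j) :
    ⁅x, y⁆ ∈ g KP (i + j) := by
  rw [mem_g, opl_lie, vec_lie]
  refine ⟨add_mem (sub_mem (comp_mem_eg hx.1 hy.1) ?_) (KP.D_mem_eg hx.2 hy.2),
    sub_mem (hx.1 _ _ hy.2) ?_⟩
  · rw [add_comm i j]; exact comp_mem_eg hy.1 hx.1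
  · rw [add_comm i j]; exact hy.1 _ _ hx.2

theorem g_van (i : ℤ) (hi : 2 < |i|) : g KP i = ⊥ := by
  rw [lt_abs] at hi
  rw [eq_bot_iff]
  intro z hz
  rw [Submodule.mem_bot]
  refine ext' ?_ ?_
  · rw [map_zero]; exact eg_zero hz.1 (by omega) (by omega) (by omega)
  · rw [map_zero]; exact tg_zero (K := K) hz.2 (by omega) (by omega)

variable (KP) in
/-- The standard 5-grading. -/
def fg : FiveGrading K KP.KL where
  g := g KP
  lie_mem := g_lie
  vanish := g_van
  internal := by
    refine isInternal_five _ g_van ?_ ?_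
    · intro z
      obtain ⟨a, ha, b, hb, c, hc, h⟩ := KP.inner_decomp (opl_mem z)
      refine ⟨mk a ha.1 0, mk_mem_g _ ha.2, mk 0 (zero_mem _) ((vec z).1, 0),
        mk_mem_g' (m_mem_tg _), mk b hb.1 0, mk_mem_g _ hb.2,
        mk 0 (zero_mem _) (0, (vec z).2), mk_mem_g' (p_mem_tg _), mk c hc.1 0,
        mk_mem_g _ hc.2, ext' ?_ ?_⟩
      · simp only [map_add, opl_mk, h, add_zero]
      · simp [map_add, vec_mk]
    · intro a ha b hb c hc d hd e he h
      have h1 := congrArg opl h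
      have h2 := congrArg vec h
      simp only [map_add, map_zero] at h1 h2
      rw [eg_zero hb.1 (by omega) (by omega) (by omega),
        eg_zero hd.1 (by omega) (by omega) (by omega), add_zero, add_zero] at h1
      rw [tg_zero (K := K) ha.2 (by omega) (by omega), tg_zero (K := K) hc.2 (by omega) (by omega),
        tg_zero (K := K) he.2 (by omega) (by omega), zero_add, add_zero, add_zero] at h2
      have h3 : ∀ x, opl a x + opl c x + opl e x = 0 := fun x => by
        rw [← LinearMap.add_apply, ← LinearMap.add_apply, h1, LinearMap.zero_apply]
      have hm1 := fun x => congrArg Prod.fst (h3 (x, 0))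
      have hm2 := fun x => congrArg Prod.snd (h3 (x, 0))
      have hp1 := fun x => congrArg Prod.fst (h3 (0, x))
      have hp2 := fun x => congrArg Prod.snd (h3 (0, x))
      simp only [Prod.fst_add, Prod.snd_add, Prod.fst_zero, Prod.snd_zero] at hm1 hm2 hp1 hp2
      simp only [eg_mm ha.1 (by omega), eg_mm he.1 (by omega), zero_add, add_zero] at hm1
      simp only [eg_mp ha.1 (by omega), eg_mp hc.1 (by omega), zero_add] at hm2
      simp only [eg_pm hc.1 (by omega), eg_pm he.1 (by omega), add_zero] at hp1
      simp only [eg_pp ha.1 (by omega), eg_pp he.1 (by omega), zero_add, add_zero] at hp2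
      have hb1 : (vec b).2 = 0 := hb.2.2.resolve_right (by omega)
      have hd1 : (vec d).1 = 0 := hd.2.1.resolve_right (by omega)
      have h4 := congrArg Prod.fst h2
      have h5 := congrArg Prod.snd h2
      rw [Prod.fst_add, hd1, add_zero] at h4
      rw [Prod.snd_add, hb1, zero_add] at h5
      refine ⟨ext' ?_ ?_, ext' ?_ ?_, ext' ?_ ?_, ext' ?_ ?_, ext' ?_ ?_⟩
      · rw [map_zero]
        exact end_zero (eg_mm ha.1 (by omega)) (eg_mp ha.1 (by omega)) hp1 (eg_pp ha.1 (by omega))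
      · rw [map_zero]; exact tg_zero (K := K) ha.2 (by omega) (by omega)
      · rw [map_zero]; exact eg_zero hb.1 (by omega) (by omega) (by omega)
      · rw [map_zero]; exact Prod.ext h4 hb1
      · rw [map_zero]
        exact end_zero hm1 (eg_mp hc.1 (by omega)) (eg_pm hc.1 (by omega)) hp2
      · rw [map_zero]; exact tg_zero (K := K) hc.2 (by omega) (by omega)
      · rw [map_zero]; exact eg_zero hd.1 (by omega) (by omega) (by omega)
      · rw [map_zero]; exact Prod.ext hd1 h5
      · rw [map_zero]
        exact end_zero (eg_mm he.1 (by omega)) hm2 (eg_pm he.1 (by omega)) (eg_pp he.1 (by omega))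
      · rw [map_zero]; exact tg_zero (K := K) he.2 (by omega) (by omega)

variable (KP) in
/-- The inclusion of `P⁻ ⊕ P⁺`. -/
def inc : Pm × Pp →ₗ[K] KP.KL where
  toFun x := mk 0 (zero_mem _) x
  map_add' x y := ext' (by simp) (by simp)
  map_smul' a x := ext' (by simp) (by simp)

@[simp] theorem opl_inc (x : Pm × Pp) : opl (inc KP x) = 0 := rfl
@[simp] theorem vec_inc (x : Pm × Pp) : vec (inc KP x) = x := rfl

theorem lie_inc (x y : Pm × Pp) : ⁅inc KP x, inc KP y⁆ = mk (KP.D x y) (KP.D_mem_innerS x y) 0 :=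
  ext' (by simp) (by simp)

theorem lie_lie_inc (x y z : Pm × Pp) :
    ⁅⁅inc KP x, inc KP y⁆, inc KP z⁆ = inc KP (KP.D x y z) := by
  rw [lie_inc]
  exact ext' (by simp [D_zero_left]) (by simp)

variable (KP) in
/-- The Kantor Lie algebra envelops the Kantor pair. -/
def env : Envelops KP (fg KP) where
  em := (inc KP).comp (LinearMap.inl K Pm Pp)
  ep := (inc KP).comp (LinearMap.inr K Pm Pp)
  inj_m x y h := congrArg (fun z => (vec z).1) h
  inj_p x y h := congrArg (fun z => (vec z).2) h
  range_m := by
    ext z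
    constructor
    · rintro ⟨x, rfl⟩
      exact mk_mem_g' (m_mem_tg x)
    · intro hz
      refine ⟨(vec z).1, ext' ?_ ?_⟩
      · exact (eg_zero hz.1 (by omega) (by omega) (by omega)).symm
      · exact Prod.ext rfl (hz.2.2.resolve_right (by omega)).symm
  range_p := by
    ext z
    constructor
    · rintro ⟨x, rfl⟩
      exact mk_mem_g' (p_mem_tg x)
    · intro hz
      refine ⟨(vec z).2, ext' ?_ ?_⟩
      · exact (eg_zero hz.1 (by omega) (by omega) (by omega)).symm
      · exact Prod.ext (hz.2.1.resolve_right (by omega)).symm rfl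
  compat_m x z y := by
    simp only [LinearMap.comp_apply, LinearMap.inl_apply, LinearMap.inr_apply, lie_lie_inc]
    congr 1
    ext <;> simp [D_fst, D_snd, tm_zero₁, tm_zero₂, tm_zero₃, tp_zero₁, tp_zero₂, tp_zero₃]
  compat_p x z y := by
    simp only [LinearMap.comp_apply, LinearMap.inl_apply, LinearMap.inr_apply, lie_lie_inc]
    congr 1
    ext <;> simp [D_fst, D_snd, tm_zero₁, tm_zero₂, tm_zero₃, tp_zero₁, tp_zero₂, tp_zero₃]

theorem inc_mem (x : Pm × Pp) : inc KP x ∈ Tsub (fg KP) := by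
  have h : inc KP x = inc KP (x.1, 0) + inc KP (0, x.2) := by
    rw [← map_add]; simp
  rw [h]
  exact Submodule.add_mem_sup (mk_mem_g' (m_mem_tg _)) (mk_mem_g' (p_mem_tg _))

theorem opl_of_mem {z : KP.KL} (hz : z ∈ Tsub (fg KP)) : opl z = 0 := by
  obtain ⟨a, ha, b, hb, rfl⟩ := Submodule.mem_sup.1 hz
  rw [map_add, eg_zero ha.1 (by omega) (by omega) (by omega),
    eg_zero hb.1 (by omega) (by omega) (by omega), add_zero]

theorem mk_mem {S : LieSubalgebra K KP.KL} (hS : ∀ x, inc KP x ∈ S)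
    {A : Module.End K (Pm × Pp)} (hA : A ∈ KP.innerS) : ∃ z ∈ S, opl z = A ∧ vec z = 0 := by
  induction hA using Submodule.span_induction with
  | mem A hA =>
    obtain ⟨x, y, rfl⟩ := hA
    refine ⟨_, S.lie_mem (hS x) (hS y), ?_⟩
    rw [lie_inc]
    exact ⟨rfl, rfl⟩
  | zero => exact ⟨0, zero_mem _, map_zero _, map_zero _⟩
  | add A B _ _ hA hB =>
    obtain ⟨z, hz, h1, h2⟩ := hA
    obtain ⟨z', hz', h1', h2'⟩ := hB
    exact ⟨z + z', add_mem hz hz', by rw [map_add, h1, h1'], by rw [map_add, h2, h2', add_zero]⟩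
  | smul a A _ hA =>
    obtain ⟨z, hz, h1, h2⟩ := hA
    exact ⟨a • z, S.smul_mem _ hz, by rw [map_smul, h1], by rw [map_smul, h2, smul_zero]⟩

theorem tight : Tight K (fg KP) := by
  refine ⟨?_, ?_⟩
  · rw [eq_top_iff]
    intro z _
    obtain ⟨w, hw, h1, h2⟩ := mk_mem
      (S := LieSubalgebra.lieSpan K KP.KL (Tsub (fg KP) : Set KP.KL))
      (fun x => LieSubalgebra.subset_lieSpan (inc_mem x)) (opl_mem z)
    have : z = w + inc KP (vec z) :=
      ext' (by rw [map_add, h1, opl_inc, add_zero]) (by rw [map_add, h2, vec_inc, zero_add])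
    rw [this]
    exact add_mem hw (LieSubalgebra.subset_lieSpan (inc_mem _))
  · intro z hz hc
    have h1 : vec z = 0 := by
      have hle : brkSpan K (Tsub (fg KP)) (Tsub (fg KP)) ≤ LinearMap.ker vec := by
        refine Submodule.span_le.2 ?_
        rintro z ⟨x, hx, y, hy, rfl⟩
        change vec ⁅x, y⁆ = 0
        rw [vec_lie, opl_of_mem hx, opl_of_mem hy]; simp
      exact hle hz
    refine ext' (LinearMap.ext fun x => ?_) (by rw [h1, map_zero])
    have h2 := congrArg vec (hc (inc KP x))
    simpa using h2

end KL

end Construct3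
end KantorPair

/-- Let `P` be a nonzero Kantor pair.  (i) `P` is simple iff there is a
simple 5-graded Lie algebra enveloping `P`.  (ii) If `L` is a simple 5-graded Lie algebra
enveloping `P`, there is a unique isomorphism of 5-graded Lie algebras of `L` onto `𝔎(P)`
extending the identity on `T_L(P) = P⁻ ⊕ P⁺`.  (`𝔎(P)` is represented by an arbitrary
5-graded Lie algebra `L'` tightly enveloping `P`.) -/
theorem statement8 {K : Type u} [CommRing K] (h6 : IsUnit (6 : K))
    {Pm : Type v} {Pp : Type w} [AddCommGroup Pm] [AddCommGroup Pp]
    [Module K Pm] [Module K Pp] (KP : KantorPair K Pm Pp)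
    (hnz : (∃ x : Pm, x ≠ 0) ∨ (∃ x : Pp, x ≠ 0)) :
    (KP.IsSimplePair ↔ Nonempty (SimpleEnvelope KP)) ∧
    (∀ (L : Type*) [LieRing L] [LieAlgebra K L] (fg : FiveGrading K L)
        (E : Envelops KP fg), LieAlgebra.IsSimple K L →
      ∀ (L' : Type*) [LieRing L'] [LieAlgebra K L'] (fg' : FiveGrading K L')
        (E' : Envelops KP fg'), Tight K fg' →
      ∃! φ : L ≃ₗ⁅K⁆ L',
        (∀ (i : ℤ) (x : L), x ∈ fg.g i → φ x ∈ fg'.g i) ∧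
        (∀ x : Pm, φ (E.em x) = E'.em x) ∧ (∀ y : Pp, φ (E.ep y) = E'.ep y)) := by
  refine ⟨⟨fun hP => ?_, ?_⟩, ?_⟩
  · exact ⟨{ L := KP.KL
             fg := KantorPair.KL.fg KP
             env := KantorPair.KL.env KP
             simple := (KantorPair.KL.env KP).simple_of_tight KantorPair.KL.tight hP }⟩
  · rintro ⟨S⟩
    let _ := S.lieRing
    let _ := S.lieAlgebra
    exact S.env.pair_simple S.simple hnz
  · intro L _ _ fg E hs L' _ _ fg' E' ht'
    exact tight_iso E E' (E.tight_of_simple hs hnz) ht'
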